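/- arXiv:2009.11048 — 11 statements merged into one kernel-verified Lean document; each statement's English description precedes it below -/
import Mathlib

section
/- Let λ ≥ χ > 0. Let w : ℝ → ℝ be differentiable with ∫_ℝ |w(y)| e^{-λ|y|} dy < ∞ and ∫_ℝ |w'(y)|² e^{-χ|y|} dy < ∞. Then ∫_ℝ |w(y) − ⟨w⟩_λ|² e^{-χ|y|} dy ≤ (4/χ²) ∫_ℝ |w'(y)|² e^{-χ|y|} dy. -/
open MeasureTheory Real

/-- The weighted average `⟨f⟩_r = (r/2) ∫ f(y) e^{-r|y|} dy`. -/
noncomputable def wavg (r : ℝ) (f : ℝ → ℝ) : ℝ :=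
  (r / 2) * ∫ y : ℝ, f y * Real.exp (-r * |y|)

lemma half_line (lam chi : ℝ) (hchi : 0 < chi) (hle : chi ≤ lam) (th : ℝ)
    (F : ℝ → ℝ) (hF : Differentiable ℝ F)
    (hA : IntegrableOn (fun y : ℝ => F y ^ 2 * Real.exp (-chi * y)) (Set.Ioi 0))
    (hB : IntegrableOn (fun y : ℝ => (deriv F y) ^ 2 * Real.exp (-chi * y)) (Set.Ioi 0))
    (hC : IntegrableOn (fun y : ℝ => F y * Real.exp (-lam * y)) (Set.Ioi 0)) :
    0 ≤ (∫ y in Set.Ioi (0:ℝ), (deriv F y) ^ 2 * Real.exp (-chi * y))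
      - chi ^ 2 / 4 * (∫ y in Set.Ioi (0:ℝ), F y ^ 2 * Real.exp (-chi * y))
      + chi / 2 * F 0 ^ 2 - 2 * th * F 0
      + 2 * th * (lam - chi / 2) * (∫ y in Set.Ioi (0:ℝ), F y * Real.exp (-lam * y))
      + th ^ 2 * (1 / (2 * lam - chi)) := by
  have hE : IntegrableOn (fun y : ℝ => Real.exp (-(2 * lam - chi) * y)) (Set.Ioi 0) :=
    exp_neg_integrableOn_Ioi 0 (by linarith)
  have hEv : ∫ y in Set.Ioi (0:ℝ), Real.exp (-(2 * lam - chi) * y) = 1 / (2 * lam - chi) := by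
    rw [integral_exp_mul_Ioi (by linarith) 0]
    simp only [mul_zero, Real.exp_zero]
    rw [neg_div, div_neg, neg_neg]
  have hmd : Measurable (deriv F) := measurable_deriv F
  have hmF : Measurable F := hF.continuous.measurable
  -- cross terms
  have hX : IntegrableOn (fun y : ℝ => deriv F y * Real.exp (-lam * y)) (Set.Ioi 0) := by
    refine Integrable.mono' (hB.add hE) (by fun_prop) (Filter.Eventually.of_forall fun y => ?_)
    have e1 : Real.exp (-chi * y) = Real.exp (-chi * y / 2) ^ 2 := by
      rw [← Real.exp_nat_mul]; congr 1; push_cast; ring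
    have e2 : Real.exp (-(2 * lam - chi) * y) = Real.exp (-(2 * lam - chi) * y / 2) ^ 2 := by
      rw [← Real.exp_nat_mul]; congr 1; push_cast; ring
    have e3 : Real.exp (-lam * y) =
        Real.exp (-chi * y / 2) * Real.exp (-(2 * lam - chi) * y / 2) := by
      rw [← Real.exp_add]; congr 1; ring
    simp only [Pi.add_apply, Real.norm_eq_abs]
    rw [e1, e2, e3, abs_le]
    constructor <;> nlinarith [sq_nonneg (deriv F y * Real.exp (-chi * y / 2) + Real.exp (-(2 * lam - chi) * y / 2)), sq_nonneg (deriv F y * Real.exp (-chi * y / 2) - Real.exp (-(2 * lam - chi) * y / 2)), sq_nonneg (deriv F y * Real.exp (-chi * y / 2)), sq_nonneg (Real.exp (-(2 * lam - chi) * y / 2))]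
  have hY : IntegrableOn (fun y : ℝ => F y * deriv F y * Real.exp (-chi * y)) (Set.Ioi 0) := by
    refine Integrable.mono' (hB.add hA) (by fun_prop) (Filter.Eventually.of_forall fun y => ?_)
    simp only [Pi.add_apply, Real.norm_eq_abs]
    have hp := Real.exp_pos (-chi * y)
    rw [← add_mul, abs_mul, abs_of_pos hp]
    refine mul_le_mul_of_nonneg_right ?_ hp.le
    rw [abs_le]
    constructor <;> nlinarith [sq_nonneg (F y + deriv F y), sq_nonneg (F y - deriv F y)]
  -- derivatives
  have hexp : ∀ (r y : ℝ), HasDerivAt (fun y : ℝ => Real.exp (-r * y)) (Real.exp (-r * y) * (-r)) y := by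
    intro r y
    have := ((hasDerivAt_id y).const_mul (-r)).exp
    simpa using this
  have hd1 : ∀ y : ℝ, HasDerivAt (fun y => F y * Real.exp (-lam * y))
      (deriv F y * Real.exp (-lam * y) - lam * (F y * Real.exp (-lam * y))) y := by
    intro y
    have h := (hF y).hasDerivAt.mul (hexp lam y)
    refine h.congr_deriv ?_
    ring
  have hd2 : ∀ y : ℝ, HasDerivAt (fun y => F y ^ 2 * Real.exp (-chi * y))
      (2 * (F y * deriv F y * Real.exp (-chi * y)) - chi * (F y ^ 2 * Real.exp (-chi * y))) y := by
    intro y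
    have h := ((hF y).hasDerivAt.pow 2).mul (hexp chi y)
    refine h.congr_deriv ?_
    simp only [Pi.pow_apply]
    push_cast
    ring
  have hi1 : IntegrableOn (fun y => deriv F y * Real.exp (-lam * y) - lam * (F y * Real.exp (-lam * y))) (Set.Ioi 0) :=
    hX.sub (hC.const_mul lam)
  have hi2 : IntegrableOn (fun y => 2 * (F y * deriv F y * Real.exp (-chi * y)) - chi * (F y ^ 2 * Real.exp (-chi * y))) (Set.Ioi 0) :=
    (hY.const_mul 2).sub (hA.const_mul chi)
  have ht1 := tendsto_zero_of_hasDerivAt_of_integrableOn_Ioi (fun y _ => hd1 y) hi1 hC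
  have ht2 := tendsto_zero_of_hasDerivAt_of_integrableOn_Ioi (fun y _ => hd2 y) hi2 hA
  have hv1 := integral_Ioi_of_hasDerivAt_of_tendsto' (fun y _ => hd1 y) hi1 ht1
  have hv2 := integral_Ioi_of_hasDerivAt_of_tendsto' (fun y _ => hd2 y) hi2 ht2
  rw [integral_sub hX (hC.const_mul lam), integral_const_mul] at hv1
  rw [integral_sub (hY.const_mul 2) (hA.const_mul chi), integral_const_mul, integral_const_mul] at hv2
  simp only [mul_zero, Real.exp_zero, mul_one] at hv1 hv2
  have hpos : 0 ≤ ∫ y in Set.Ioi (0:ℝ), (((((deriv F y) ^ 2 * Real.exp (-chi * y)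
      + chi ^ 2 / 4 * (F y ^ 2 * Real.exp (-chi * y)))
      - chi * (F y * deriv F y * Real.exp (-chi * y)))
      + 2 * th * (deriv F y * Real.exp (-lam * y)))
      - th * chi * (F y * Real.exp (-lam * y)))
      + th ^ 2 * Real.exp (-(2 * lam - chi) * y) := by
    refine integral_nonneg fun y => ?_
    have e2 : Real.exp (-(2 * lam - chi) * y) =
        Real.exp (-chi * y) * Real.exp (-(lam - chi) * y) ^ 2 := by
      rw [← Real.exp_nat_mul, ← Real.exp_add]; congr 1; push_cast; ring
    have e3 : Real.exp (-lam * y) =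
        Real.exp (-chi * y) * Real.exp (-(lam - chi) * y) := by
      rw [← Real.exp_add]; congr 1; ring
    have : 0 ≤ Real.exp (-chi * y) *
      (deriv F y - chi / 2 * F y + th * Real.exp (-(lam - chi) * y)) ^ 2 := by positivity
    simp only [Pi.zero_apply]
    rw [e2, e3]
    nlinarith [this]
  have j1 : IntegrableOn (fun y => (deriv F y) ^ 2 * Real.exp (-chi * y)
      + chi ^ 2 / 4 * (F y ^ 2 * Real.exp (-chi * y))) (Set.Ioi 0) :=
    hB.add (hA.const_mul (chi ^ 2 / 4))
  have j2 : IntegrableOn (fun y => ((deriv F y) ^ 2 * Real.exp (-chi * y)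
      + chi ^ 2 / 4 * (F y ^ 2 * Real.exp (-chi * y)))
      - chi * (F y * deriv F y * Real.exp (-chi * y))) (Set.Ioi 0) :=
    j1.sub (hY.const_mul chi)
  have j3 : IntegrableOn (fun y => (((deriv F y) ^ 2 * Real.exp (-chi * y)
      + chi ^ 2 / 4 * (F y ^ 2 * Real.exp (-chi * y)))
      - chi * (F y * deriv F y * Real.exp (-chi * y)))
      + 2 * th * (deriv F y * Real.exp (-lam * y))) (Set.Ioi 0) :=
    j2.add (hX.const_mul (2 * th))
  have j4 : IntegrableOn (fun y => ((((deriv F y) ^ 2 * Real.exp (-chi * y)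
      + chi ^ 2 / 4 * (F y ^ 2 * Real.exp (-chi * y)))
      - chi * (F y * deriv F y * Real.exp (-chi * y)))
      + 2 * th * (deriv F y * Real.exp (-lam * y)))
      - th * chi * (F y * Real.exp (-lam * y))) (Set.Ioi 0) :=
    j3.sub (hC.const_mul (th * chi))
  have j5 := hE.const_mul (th ^ 2)
  rw [integral_add j4 j5, integral_sub j3 (hC.const_mul (th * chi)),
    integral_add j2 (hX.const_mul (2 * th)), integral_sub j1 (hY.const_mul chi),
    integral_add hB (hA.const_mul (chi ^ 2 / 4))] at hpos
  simp only [integral_const_mul] at hpos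
  rw [hEv] at hpos
  linear_combination hpos + 2 * th * hv1 - chi / 2 * hv2

lemma split_line (f : ℝ → ℝ) (hf : Integrable f) :
    ∫ y, f y = (∫ y in Set.Ioi (0:ℝ), f y) + ∫ y in Set.Ioi (0:ℝ), f (-y) := by
  rw [integral_comp_neg_Ioi, neg_zero, add_comm]
  exact (intervalIntegral.integral_Iic_add_Ioi hf.integrableOn hf.integrableOn).symm

/-- Improved Poincaré inequality with exponential weight. -/
theorem improved_poincare (lam chi : ℝ) (hchi : 0 < chi) (hle : chi ≤ lam)
    (w : ℝ → ℝ) (hw : Differentiable ℝ w)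
    (h1 : Integrable (fun y : ℝ => |w y| * Real.exp (-lam * |y|)))
    (h2 : Integrable (fun y : ℝ => (deriv w y) ^ 2 * Real.exp (-chi * |y|))) :
    ∫ y : ℝ, (w y - wavg lam w) ^ 2 * Real.exp (-chi * |y|)
      ≤ (4 / chi ^ 2) * ∫ y : ℝ, (deriv w y) ^ 2 * Real.exp (-chi * |y|) := by
  have hlam : 0 < lam := hchi.trans_le hle
  by_cases hA : Integrable (fun y : ℝ => (w y - wavg lam w) ^ 2 * Real.exp (-chi * |y|))
  swap
  · rw [integral_undef hA]
    have : 0 ≤ ∫ y : ℝ, (deriv w y) ^ 2 * Real.exp (-chi * |y|) :=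
      integral_nonneg fun y => by positivity
    positivity
  have hmw : Continuous w := hw.continuous
  have h1' : Integrable (fun y : ℝ => w y * Real.exp (-lam * |y|)) := by
    refine h1.mono' (by fun_prop) (Filter.Eventually.of_forall fun y => ?_)
    simp [abs_mul]
  have hEv : ∫ y : ℝ, Real.exp (-lam * |y|) = 2 / lam := by
    rw [integral_comp_abs (f := fun y => Real.exp (-lam * y)),
      integral_exp_mul_Ioi (by linarith) 0]
    simp only [mul_zero, Real.exp_zero]
    rw [neg_div, div_neg, neg_neg]; ring
  have hEi : Integrable (fun y : ℝ => Real.exp (-lam * |y|)) := by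
    by_contra h
    rw [integral_undef h] at hEv
    have : 0 < 2 / lam := by positivity
    linarith
  set m := wavg lam w with hm
  have hC : Integrable (fun y : ℝ => (w y - m) * Real.exp (-lam * |y|)) := by
    have := h1'.sub (hEi.const_mul m)
    refine this.congr (Filter.Eventually.of_forall fun y => ?_)
    simp [sub_mul]
  have hCv : ∫ y : ℝ, (w y - m) * Real.exp (-lam * |y|) = 0 := by
    simp only [sub_mul]
    rw [integral_sub h1' (hEi.const_mul m), integral_const_mul, hEv, hm, wavg]
    field_simp
    ring
  have hsA := split_line _ hA
  have hsB := split_line _ h2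
  have hsC := split_line _ hC
  rw [hCv] at hsC
  have key : ∀ (g : ℝ → ℝ) (r : ℝ),
      ∫ y in Set.Ioi (0:ℝ), g y * Real.exp (-r * |y|) =
      ∫ y in Set.Ioi (0:ℝ), g y * Real.exp (-r * y) := fun g r =>
    setIntegral_congr_fun measurableSet_Ioi fun y hy => by
      simp only [abs_of_pos (Set.mem_Ioi.1 hy)]
  have keyI : ∀ (g : ℝ → ℝ) (r : ℝ), Integrable (fun y => g y * Real.exp (-r * |y|)) →
      IntegrableOn (fun y => g y * Real.exp (-r * y)) (Set.Ioi 0) := fun g r h =>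
    h.integrableOn.congr_fun (fun y hy => by
      simp only [abs_of_pos (Set.mem_Ioi.1 hy)]) measurableSet_Ioi
  have hneg : ∀ (g : ℝ → ℝ) (r : ℝ), Integrable (fun y => g y * Real.exp (-r * |y|)) →
      Integrable (fun y => g (-y) * Real.exp (-r * |y|)) := fun g r h => by
    simpa using h.comp_neg
  have hdn : ∀ y, deriv (fun y => w (-y) - m) y = - deriv w (-y) := fun y => by
    rw [deriv_sub_const, deriv_comp_neg]
  have hdp : ∀ y, deriv (fun y => w y - m) y = deriv w y := fun y => by
    rw [deriv_sub_const]
  simp only [abs_neg] at hsA hsB hsC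
  rw [key (fun y => (w y - m) ^ 2), key (fun y => (w (-y) - m) ^ 2)] at hsA
  rw [key (fun y => (deriv w y) ^ 2), key (fun y => (deriv w (-y)) ^ 2)] at hsB
  rw [key (fun y => (w y - m)), key (fun y => (w (-y) - m))] at hsC
  have P := half_line lam chi hchi hle (chi * (w 0 - m)) (fun y => w y - m) (by fun_prop)
    (keyI _ _ hA) (by simpa only [hdp] using keyI _ _ h2) (keyI _ _ hC)
  have N := half_line lam chi hchi hle (chi * (w 0 - m)) (fun y => w (-y) - m) (by fun_prop)
    (keyI _ _ (hneg (fun y => (w y - m) ^ 2) _ hA))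
    (by simpa only [hdn, neg_sq] using keyI _ _ (hneg (fun y => (deriv w y) ^ 2) _ h2))
    (keyI _ _ (hneg (fun y => w y - m) _ hC))
  simp only [hdn, hdp, neg_sq, neg_zero] at P N
  have hq : chi * (1 / (2 * lam - chi)) ≤ 1 := by
    rw [mul_one_div, div_le_one (by linarith)]; linarith
  have hq2 := mul_le_mul_of_nonneg_left hq (mul_nonneg hchi.le (sq_nonneg (w 0 - m)))
  have hq3 : 0 ≤ chi * (w 0 - m) ^ 2 := by positivity
  have fin : chi ^ 2 / 4 * ∫ y : ℝ, (w y - m) ^ 2 * Real.exp (-chi * |y|)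
      ≤ ∫ y : ℝ, (deriv w y) ^ 2 * Real.exp (-chi * |y|) := by
    rw [hsA, hsB]
    linear_combination P + N + 2 * hq2 + hq3 - 2 * (chi * (w 0 - m)) * (lam - chi / 2) * hsC
  rw [div_mul_eq_mul_div, le_div_iff₀ (by positivity)]
  linarith
end

section
/- Let λ ≥ χ > 0. For every constant C < 4/χ² there exists a differentiable function w : ℝ → ℝ with ∫_ℝ |w(y)| e^{-λ|y|} dy < ∞ and 0 < ∫_ℝ |w'(y)|² e^{-χ|y|} dy < ∞ such that ∫_ℝ |w(y) − ⟨w⟩_λ|² e^{-χ|y|} dy > C ∫_ℝ |w'(y)|² e^{-χ|y|} dy. In other words, the constant 4/χ² in the improved Poincaré inequality is optimal, independently of λ. -/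
open MeasureTheory Real

lemma aux_exp (k : ℝ) (hk : 0 < k) : ∫ y : ℝ, Real.exp (-k * |y|) = 2 / k := by
  rw [integral_comp_abs (f := fun x => Real.exp (-k * x)), integral_exp_mul_Ioi (by linarith)]
  simp
  field_simp

lemma aux_exp_int (k : ℝ) (hk : 0 < k) : Integrable (fun y : ℝ => Real.exp (-k * |y|)) := by
  by_contra h
  have h1 := aux_exp k hk
  rw [integral_undef h] at h1
  have : 0 < 2 / k := by positivity
  linarith

lemma aux_cosh_eq (r b : ℝ) : (fun y : ℝ => Real.cosh (b * y) * Real.exp (-r * |y|)) =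
    fun y => (1 / 2) * (Real.exp (-(r - b) * |y|) + Real.exp (-(r + b) * |y|)) := by
  funext y
  have : Real.cosh (b * y) = Real.cosh (b * |y|) := by
    rcases abs_choice y with h | h <;> rw [h]
    rw [mul_neg, Real.cosh_neg]
  rw [this, Real.cosh_eq, show -(r - b) * |y| = b * |y| + -r * |y| by ring,
    show -(r + b) * |y| = -(b * |y|) + -r * |y| by ring, Real.exp_add, Real.exp_add]
  ring

lemma aux_cosh_int (r b : ℝ) (hb : 0 ≤ b) (hr : b < r) :
    Integrable (fun y : ℝ => Real.cosh (b * y) * Real.exp (-r * |y|)) := by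
  rw [aux_cosh_eq]
  exact ((aux_exp_int _ (by linarith)).add (aux_exp_int _ (by linarith))).const_mul _

lemma aux_cosh (r b : ℝ) (hb : 0 ≤ b) (hr : b < r) :
    ∫ y : ℝ, Real.cosh (b * y) * Real.exp (-r * |y|) = 1 / (r - b) + 1 / (r + b) := by
  rw [aux_cosh_eq, integral_const_mul,
    integral_add (aux_exp_int _ (by linarith)) (aux_exp_int _ (by linarith)),
    aux_exp _ (by linarith), aux_exp _ (by linarith)]
  ring



/-- Optimality of the constant `4/χ²` in the improved Poincaré inequality,
independently of `λ ≥ χ`. -/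
theorem improved_poincare_optimal (lam chi : ℝ) (hchi : 0 < chi) (hle : chi ≤ lam)
    (C : ℝ) (hC : C < 4 / chi ^ 2) :
    ∃ w : ℝ → ℝ, Differentiable ℝ w ∧
      Integrable (fun y : ℝ => |w y| * Real.exp (-lam * |y|)) ∧
      Integrable (fun y : ℝ => (deriv w y) ^ 2 * Real.exp (-chi * |y|)) ∧
      0 < ∫ y : ℝ, (deriv w y) ^ 2 * Real.exp (-chi * |y|) ∧
      (∫ y : ℝ, (w y - wavg lam w) ^ 2 * Real.exp (-chi * |y|))
        > C * ∫ y : ℝ, (deriv w y) ^ 2 * Real.exp (-chi * |y|) := by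
  obtain ⟨a, ha0, ha, hCa⟩ : ∃ a : ℝ, 0 < a ∧ a < chi / 2 ∧ C * (2 * chi ^ 2 - 4 * a ^ 2) < 4 := by
    have hC' : C * (2 * chi ^ 2 - 4 * (chi / 2) ^ 2) < 4 := by
      rw [lt_div_iff₀ (by positivity)] at hC
      nlinarith
    have hcont : Continuous fun a : ℝ => C * (2 * chi ^ 2 - 4 * a ^ 2) := by fun_prop
    have h1 := (hcont.tendsto (chi / 2)).eventually (gt_mem_nhds hC')
    have h2 : Set.Ioo 0 (chi / 2) ∈ nhdsWithin (chi / 2) (Set.Iio (chi / 2)) :=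
      Ioo_mem_nhdsLT (by positivity)
    obtain ⟨a, h, h'⟩ := ((h1.filter_mono nhdsWithin_le_nhds).and h2).exists
    exact ⟨a, h'.1, h'.2, h⟩
  have hd : deriv (fun y : ℝ => Real.sinh (a * y)) = fun y => a * Real.cosh (a * y) := by
    funext y
    have h := ((hasDerivAt_id y).const_mul a).sinh
    simp only [id] at h
    rw [h.deriv]; ring
  have hav : wavg lam (fun y : ℝ => Real.sinh (a * y)) = 0 := by
    unfold wavg
    have h := integral_neg_eq_self
      (fun y : ℝ => Real.sinh (a * y) * Real.exp (-lam * |y|)) volume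
    simp only [mul_neg, Real.sinh_neg, abs_neg, neg_mul, integral_neg] at h
    simp only [neg_mul]
    have h0 : ∫ y : ℝ, Real.sinh (a * y) * Real.exp (-(lam * |y|)) = 0 := by linarith
    rw [h0, mul_zero]
  have hI2 := aux_cosh_int chi (2 * a) (by positivity) (by linarith)
  have hI0 := aux_exp_int chi hchi
  have e1 : (fun y : ℝ => (a * Real.cosh (a * y)) ^ 2 * Real.exp (-chi * |y|)) =
      fun y => (a ^ 2 / 2) * (Real.cosh (2 * a * y) * Real.exp (-chi * |y|) +
        Real.exp (-chi * |y|)) := by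
    funext y
    have h1 := Real.cosh_two_mul (a * y)
    have h2 := Real.cosh_sq (a * y)
    rw [mul_assoc 2 a y, h1, mul_pow, h2]; ring
  have e2 : (fun y : ℝ => (Real.sinh (a * y) - 0) ^ 2 * Real.exp (-chi * |y|)) =
      fun y => (1 / 2) * (Real.cosh (2 * a * y) * Real.exp (-chi * |y|) -
        Real.exp (-chi * |y|)) := by
    funext y
    have h1 := Real.cosh_two_mul (a * y)
    have h2 := Real.cosh_sq (a * y)
    rw [mul_assoc 2 a y, h1, h2]; ring
  have p1 : 0 < chi - 2 * a := by linarith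
  have p2 : 0 < chi + 2 * a := by linarith
  have q1 := ne_of_gt p1
  have q2 := ne_of_gt p2
  have key : 1 / (chi - 2 * a) + 1 / (chi + 2 * a) =
      2 * chi / ((chi - 2 * a) * (chi + 2 * a)) := by
    rw [div_add_div _ _ q1 q2]
    congr 1
    ring
  have hP : (chi - 2 * a) * (chi + 2 * a) = chi ^ 2 - 4 * a ^ 2 := by ring
  have hP0 : (chi - 2 * a) * (chi + 2 * a) ≠ 0 := mul_ne_zero q1 q2
  have hD : ∫ y : ℝ, (a * Real.cosh (a * y)) ^ 2 * Real.exp (-chi * |y|) =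
      a ^ 2 * (2 * chi ^ 2 - 4 * a ^ 2) / (chi * ((chi - 2 * a) * (chi + 2 * a))) := by
    rw [e1, integral_const_mul, integral_add hI2 hI0,
      aux_cosh _ _ (by positivity) (by linarith), aux_exp _ hchi, key]
    generalize (chi - 2 * a) * (chi + 2 * a) = P at hP hP0
    field_simp
    rw [hP]
    ring
  have hS : ∫ y : ℝ, (Real.sinh (a * y) - 0) ^ 2 * Real.exp (-chi * |y|) =
      a ^ 2 * 4 / (chi * ((chi - 2 * a) * (chi + 2 * a))) := by
    rw [e2, integral_const_mul, integral_sub hI2 hI0,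
      aux_cosh _ _ (by positivity) (by linarith), aux_exp _ hchi]
    field_simp
    ring
  refine ⟨fun y => Real.sinh (a * y), by fun_prop, ?_, ?_, ?_, ?_⟩
  · refine (aux_cosh_int lam a ha0.le (by linarith)).mono' (by fun_prop) ?_
    filter_upwards with y
    rw [Real.norm_eq_abs, abs_mul, abs_abs, abs_of_pos (Real.exp_pos _), Real.abs_sinh,
      ← Real.cosh_abs (a * y)]
    exact mul_le_mul_of_nonneg_right (Real.sinh_lt_cosh _).le (Real.exp_pos _).le
  · rw [hd, e1]
    exact (hI2.add hI0).const_mul _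
  · rw [hd, hD]
    have : 0 < 2 * chi ^ 2 - 4 * a ^ 2 := by nlinarith
    positivity
  · rw [hd, hD, hav, hS, gt_iff_lt, ← mul_div_assoc]
    apply div_lt_div_of_pos_right _ (by positivity)
    have : 0 < a ^ 2 := by positivity
    nlinarith
end

section
/- Let χ > 0 and let w : ℝ → ℝ be differentiable with ∫_ℝ |w'(y)|² e^{-χ|y|} dy < ∞. Then ∫_ℝ |w(y) − w(0)|² e^{-χ|y|} dy ≤ (4/χ²) ∫_ℝ |w'(y)|² e^{-χ|y|} dy. -/
open MeasureTheory Real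

/-- Hardy-type inequality with two-sided exponential weight `e^{-χ|y|}`. -/
theorem hardy_exponential_weight (chi : ℝ) (hchi : 0 < chi)
    (w : ℝ → ℝ) (hw : Differentiable ℝ w)
    (h2 : Integrable (fun y : ℝ => (deriv w y) ^ 2 * Real.exp (-chi * |y|))) :
    ∫ y : ℝ, (w y - w 0) ^ 2 * Real.exp (-chi * |y|)
      ≤ (4 / chi ^ 2) * ∫ y : ℝ, (deriv w y) ^ 2 * Real.exp (-chi * |y|) := by
  by_cases h1 : Integrable (fun y : ℝ => (w y - w 0) ^ 2 * Real.exp (-chi * |y|))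
  swap
  · rw [integral_undef h1]
    have : 0 ≤ ∫ y : ℝ, (deriv w y) ^ 2 * Real.exp (-chi * |y|) :=
      integral_nonneg fun y => by positivity
    positivity
  let φ : ℝ → ℝ := fun y => (2 / chi) * ((deriv w y) ^ 2 * Real.exp (-chi * |y|))
    - (chi / 2) * ((w y - w 0) ^ 2 * Real.exp (-chi * |y|))
  have hφ : Integrable φ := (h2.const_mul _).sub (h1.const_mul _)
  have hc : Continuous w := hw.continuous
  have key : ∀ a b e : ℝ, 0 ≤ e →
      2 * a * b * e ≤ (2 / chi) * (b ^ 2 * e) + (chi / 2) * (a ^ 2 * e) := by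
    intro a b e he
    have : (2 / chi) * (b ^ 2 * e) + (chi / 2) * (a ^ 2 * e) - 2 * a * b * e
        = (2 * b - chi * a) ^ 2 * e / (2 * chi) := by
      field_simp
      ring
    have h : 0 ≤ (2 * b - chi * a) ^ 2 * e / (2 * chi) := by positivity
    linarith
  have hpos : ∀ R : ℝ, 0 ≤ R → 0 ≤ ∫ y in (0:ℝ)..R, φ y := by
    intro R hR
    have := intervalIntegral.sub_le_integral_of_hasDeriv_right_of_le (a := 0) (b := R)
      (g := fun y => (w y - w 0) ^ 2 * Real.exp (-chi * y))
      (g' := fun y => 2 * (w y - w 0) * deriv w y * Real.exp (-chi * y)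
        + (w y - w 0) ^ 2 * (Real.exp (-chi * y) * (-chi))) (φ := φ) hR
      (by fun_prop) (fun x hx => by
        have h := (((hw x).hasDerivAt.sub_const (w 0)).pow 2).mul
          (((hasDerivAt_id x).const_mul (-chi)).exp)
        refine HasDerivAt.hasDerivWithinAt ?_
        exact HasDerivAt.congr_deriv h (by simp)) hφ.integrableOn (fun x hx => by
        simp only [φ, abs_of_pos hx.1]
        have := key (w x - w 0) (deriv w x) (Real.exp (-chi * x)) (exp_pos _).le
        linarith)
    refine le_trans ?_ this
    simp only [sub_self]
    have : 0 ≤ (w R - w 0) ^ 2 * Real.exp (-chi * R) := by positivity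
    linarith
  have hneg : ∀ R : ℝ, 0 ≤ R → 0 ≤ ∫ y in (-R)..(0:ℝ), φ y := by
    intro R hR
    have := intervalIntegral.sub_le_integral_of_hasDeriv_right_of_le (a := -R) (b := 0)
      (g := fun y => -((w y - w 0) ^ 2 * Real.exp (chi * y)))
      (g' := fun y => -(2 * (w y - w 0) * deriv w y * Real.exp (chi * y)
        + (w y - w 0) ^ 2 * (Real.exp (chi * y) * chi))) (φ := φ) (by linarith)
      (by fun_prop) (fun x hx => by
        have h := ((((hw x).hasDerivAt.sub_const (w 0)).pow 2).mul
          (((hasDerivAt_id x).const_mul chi).exp)).neg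
        refine HasDerivAt.hasDerivWithinAt ?_
        exact HasDerivAt.congr_deriv h (by simp)) hφ.integrableOn (fun x hx => by
        simp only [φ, abs_of_neg hx.2, neg_mul_neg]
        have := key (w x - w 0) (-deriv w x) (Real.exp (chi * x)) (exp_pos _).le
        rw [neg_sq] at this
        linarith)
    refine le_trans ?_ this
    simp only [sub_self]
    have : 0 ≤ (w (-R) - w 0) ^ 2 * Real.exp (chi * (-R)) := by positivity
    linarith
  have hlim := intervalIntegral_tendsto_integral hφ Filter.tendsto_neg_atTop_atBot
    Filter.tendsto_id
  have h0 : 0 ≤ ∫ y, φ y := by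
    refine ge_of_tendsto hlim ?_
    filter_upwards [Filter.eventually_ge_atTop 0] with R hR
    rw [← intervalIntegral.integral_add_adjacent_intervals (b := 0)
      hφ.intervalIntegrable hφ.intervalIntegrable]
    exact add_nonneg (hneg R hR) (hpos R hR)
  simp only [φ] at h0
  rw [integral_sub (h2.const_mul _) (h1.const_mul _), integral_const_mul, integral_const_mul] at h0
  generalize (∫ y : ℝ, (w y - w 0) ^ 2 * Real.exp (-chi * |y|)) = A at *
  generalize (∫ y : ℝ, (deriv w y) ^ 2 * Real.exp (-chi * |y|)) = B at *
  have h3 : 4 / chi ^ 2 * B - A = (2 / chi) * (2 / chi * B - chi / 2 * A) := by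
    field_simp
    ring
  have h4 : 0 ≤ (2 / chi) * (2 / chi * B - chi / 2 * A) := by positivity
  linarith
end

section
/- Let λ ≥ χ > 0. The kernel Ω_{λ,χ}(x,y) = (M_λ(x) − M_χ(x))(M_λ(y) − M_χ(y)) + (1 − M_χ(max(x,y))) · M_χ(min(x,y)) is symmetric, Ω_{λ,χ}(x,y) = Ω_{λ,χ}(y,x), and non-negative: Ω_{λ,χ}(x,y) ≥ 0 for all x, y ∈ ℝ. -/
open MeasureTheory Real

/-- The cumulative distribution function `M_r(x) = ∫_{-∞}^x (r/2) e^{-r|z|} dz`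
of the two-sided exponential density with rate `r`. -/
noncomputable def Mcdf (r : ℝ) (x : ℝ) : ℝ :=
  ∫ z in Set.Iio x, (r / 2) * Real.exp (-r * |z|)

/-- The kernel `Ω_{λ,χ}`. -/
noncomputable def OmegaKer (lam chi : ℝ) (x y : ℝ) : ℝ :=
  (Mcdf lam x - Mcdf chi x) * (Mcdf lam y - Mcdf chi y)
    + (1 - Mcdf chi (max x y)) * Mcdf chi (min x y)

lemma my_intL (r x : ℝ) (hr : 0 < r) (hx : x ≤ 0) :
    IntegrableOn (fun z => (r / 2) * Real.exp (-r * |z|)) (Set.Iic x) ∧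
    ∫ z in Set.Iic x, (r / 2) * Real.exp (-r * |z|) = exp (r * x) / 2 := by
  have h : Set.EqOn (fun z => (r / 2) * Real.exp (-r * |z|)) (fun z => (r/2) * Real.exp (r * z))
      (Set.Iic x) := by
    intro z hz
    have hz' : z ≤ x := hz
    simp only [abs_of_nonpos (hz'.trans hx)]
    ring_nf
  constructor
  · rw [integrableOn_congr_fun h measurableSet_Iic]
    exact (integrableOn_exp_mul_Iic hr x).const_mul _
  · rw [setIntegral_congr_fun measurableSet_Iic h, integral_const_mul, integral_exp_mul_Iic hr]
    field_simp

lemma my_intR (r x : ℝ) (hr : 0 < r) (hx : 0 ≤ x) :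
    IntegrableOn (fun z => (r / 2) * Real.exp (-r * |z|)) (Set.Ioi x) ∧
    ∫ z in Set.Ioi x, (r / 2) * Real.exp (-r * |z|) = exp (-r * x) / 2 := by
  have h : Set.EqOn (fun z => (r / 2) * Real.exp (-r * |z|)) (fun z => (r/2) * Real.exp (-r * z))
      (Set.Ioi x) := by
    intro z hz
    have hz' : x < z := hz
    simp only [abs_of_nonneg (hx.trans hz'.le)]
  have hr' : -r < 0 := by linarith
  constructor
  · rw [integrableOn_congr_fun h measurableSet_Ioi]
    exact (integrableOn_exp_mul_Ioi hr' x).const_mul _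
  · rw [setIntegral_congr_fun measurableSet_Ioi h, integral_const_mul, integral_exp_mul_Ioi hr']
    field_simp

lemma my_M_neg (r x : ℝ) (hr : 0 < r) (hx : x ≤ 0) : Mcdf r x = exp (r * x) / 2 := by
  rw [Mcdf, ← integral_Iic_eq_integral_Iio, (my_intL r x hr hx).2]

lemma my_M_pos (r x : ℝ) (hr : 0 < r) (hx : 0 ≤ x) : Mcdf r x = 1 - exp (-r * x) / 2 := by
  rw [Mcdf, ← integral_Iic_eq_integral_Iio]
  have hL := my_intL r 0 hr le_rfl
  have hR := my_intR r 0 hr le_rfl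
  have hX := my_intR r x hr hx
  have hall : Integrable (fun z => (r / 2) * Real.exp (-r * |z|)) := by
    rw [← integrableOn_univ, ← Set.Iic_union_Ioi (a := (0:ℝ))]
    exact hL.1.union hR.1
  have h0 := intervalIntegral.integral_Iic_add_Ioi hL.1 hR.1
  have h1 := intervalIntegral.integral_Iic_add_Ioi (hall.integrableOn (s := Set.Iic x)) hX.1
  rw [hL.2, hR.2] at h0
  rw [hX.2] at h1
  simp at h0 h1 ⊢
  linarith

lemma my_symm (lam chi x y : ℝ) : OmegaKer lam chi x y = OmegaKer lam chi y x := by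
  unfold OmegaKer
  rw [max_comm, min_comm]
  ring

lemma my_nonneg (lam chi : ℝ) (hchi : 0 < chi) (hle : chi ≤ lam) (x y : ℝ) (hxy : x ≤ y) :
    0 ≤ OmegaKer lam chi x y := by
  have hl : 0 < lam := by linarith
  unfold OmegaKer
  rw [max_eq_right hxy, min_eq_left hxy]
  have neg : ∀ t : ℝ, t ≤ 0 → exp (lam * t) ≤ exp (chi * t) ∧ exp (chi * t) ≤ 1 := fun t ht =>
    ⟨exp_le_exp.2 (by nlinarith), exp_le_one_iff.2 (by nlinarith)⟩
  have pos : ∀ t : ℝ, 0 ≤ t → exp (-lam * t) ≤ exp (-chi * t) ∧ exp (-chi * t) ≤ 1 := fun t ht =>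
    ⟨exp_le_exp.2 (by nlinarith), exp_le_one_iff.2 (by nlinarith)⟩
  rcases le_total x 0 with hx | hx <;> rcases le_total y 0 with hy | hy
  · rw [my_M_neg _ _ hl hx, my_M_neg _ _ hl hy, my_M_neg _ _ hchi hx, my_M_neg _ _ hchi hy]
    have h1 := neg x hx
    have h2 := neg y hy
    exact add_nonneg (mul_nonneg_of_nonpos_of_nonpos (by linarith) (by linarith))
      (mul_nonneg (by linarith) (by positivity))
  · rw [my_M_neg _ _ hl hx, my_M_pos _ _ hl hy, my_M_neg _ _ hchi hx, my_M_pos _ _ hchi hy]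
    have h1 := neg x hx
    have h2 := pos y hy
    have p1 := exp_pos (lam * x)
    have p2 := exp_pos (-lam * y)
    have := mul_le_mul (sub_le_self (exp (chi * x)) p1.le) (sub_le_self (exp (-chi * y)) p2.le)
      (by linarith) (exp_pos _).le
    linarith
  · have : x = 0 := by linarith
    have : y = 0 := by linarith
    subst x y
    rw [my_M_neg _ _ hl le_rfl, my_M_neg _ _ hchi le_rfl]
    norm_num
  · rw [my_M_pos _ _ hl hx, my_M_pos _ _ hl hy, my_M_pos _ _ hchi hx, my_M_pos _ _ hchi hy]
    have h1 := pos x hx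
    have h2 := pos y hy
    have p := exp_pos (-chi * y)
    exact add_nonneg (mul_nonneg (by linarith) (by linarith))
      (mul_nonneg (by linarith) (by linarith))

/-- The kernel `Ω_{λ,χ}` is symmetric and non-negative for `λ ≥ χ > 0`. -/
theorem omega_symm_nonneg (lam chi : ℝ) (hchi : 0 < chi) (hle : chi ≤ lam) :
    (∀ x y : ℝ, OmegaKer lam chi x y = OmegaKer lam chi y x) ∧
    (∀ x y : ℝ, 0 ≤ OmegaKer lam chi x y) := by
  refine ⟨my_symm lam chi, fun x y => ?_⟩
  rcases le_total x y with h | h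
  · exact my_nonneg lam chi hchi hle x y h
  · rw [my_symm]
    exact my_nonneg lam chi hchi hle y x h
end

section
/- Let λ ≥ 1. Then for every x ∈ ℝ, e^{|x|/2} ∫_ℝ Ω_{λ,1}(x, y) e^{|y|/2} dy ≤ 2, where the integral converges absolutely. -/
open MeasureTheory Real

lemma ii_expIic (a : ℝ) (ha : 0 < a) (c : ℝ) : IntegrableOn (fun z => Real.exp (a * z)) (Set.Iic c) :=
  integrableOn_exp_mul_Iic ha c

lemma Mcdf_nonpos (r : ℝ) (hr : 0 < r) (x : ℝ) (hx : x ≤ 0) : Mcdf r x = Real.exp (r * x) / 2 := by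
  unfold Mcdf
  rw [← integral_Iic_eq_integral_Iio]
  rw [setIntegral_congr_fun (g := fun z => (r/2) * Real.exp (r * z)) measurableSet_Iic]
  · rw [integral_const_mul, integral_exp_mul_Iic hr]
    field_simp
  · intro z hz
    have : z ≤ 0 := le_trans hz hx
    simp only [abs_of_nonpos this]
    ring_nf

lemma Mcdf_nonneg (r : ℝ) (hr : 0 < r) (x : ℝ) (hx : 0 ≤ x) :
    Mcdf r x = 1 - Real.exp (-r * x) / 2 := by
  have h0 := Mcdf_nonpos r hr 0 le_rfl
  unfold Mcdf at *
  rw [← integral_Iic_eq_integral_Iio] at *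
  have i1 : IntegrableOn (fun z => (r / 2) * Real.exp (-r * |z|)) (Set.Iic 0) := by
    refine IntegrableOn.congr_fun ((ii_expIic r hr 0).const_mul (r/2)) ?_ measurableSet_Iic
    intro z hz
    simp only [abs_of_nonpos (show z ≤ 0 from hz)]
    ring_nf
  have i2 : IntegrableOn (fun z => (r / 2) * Real.exp (-r * |z|)) (Set.Ioc 0 x) :=
    (Continuous.integrableOn_Icc (by fun_prop)).mono_set Set.Ioc_subset_Icc_self
  rw [← Set.Iic_union_Ioc_eq_Iic hx, setIntegral_union (Set.Iic_disjoint_Ioc le_rfl)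
    measurableSet_Ioc i1 i2, h0]
  have : ∫ z in Set.Ioc 0 x, (r / 2) * Real.exp (-r * |z|) = 1/2 - Real.exp (-r * x) / 2 := by
    rw [setIntegral_congr_fun (g := fun z => (r/2) * Real.exp (-r * z)) measurableSet_Ioc]
    · rw [← intervalIntegral.integral_of_le hx]
      rw [intervalIntegral.integral_eq_sub_of_hasDerivAt (f := fun z => -(Real.exp (-r * z) / 2))]
      · simp; ring
      · intro z _
        have := ((((hasDerivAt_id z).const_mul (-r)).exp).div_const 2).neg
        refine HasDerivAt.congr_deriv (f := fun z => -(Real.exp (-r * z) / 2)) this ?_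
        simp only [id]; ring
      · exact Continuous.intervalIntegrable (by fun_prop) _ _
    · intro z hz
      simp only [abs_of_pos hz.1]
  rw [this]; simp; ring

lemma Mcdf_neg (r : ℝ) (hr : 0 < r) (x : ℝ) : Mcdf r (-x) = 1 - Mcdf r x := by
  rcases le_total 0 x with h | h
  · rw [Mcdf_nonneg r hr x h, Mcdf_nonpos r hr (-x) (by linarith)]
    ring_nf
  · rw [Mcdf_nonpos r hr x h, Mcdf_nonneg r hr (-x) (by linarith)]
    ring_nf

lemma D_integrable (l : ℝ) (hl : 1 ≤ l) :
    Integrable (fun y => (Mcdf l y - Mcdf 1 y) * Real.exp (|y| / 2)) := by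
  have h1 : IntegrableOn (fun y => (Mcdf l y - Mcdf 1 y) * Real.exp (|y| / 2)) (Set.Iic 0) := by
    refine IntegrableOn.congr_fun (((ii_expIic (l - 1/2) (by linarith) 0).sub
      (ii_expIic (1/2) (by norm_num) 0)).const_mul (1/2)) ?_ measurableSet_Iic
    intro y hy
    have hy' : y ≤ 0 := hy
    simp only [Pi.sub_apply, abs_of_nonpos hy', Mcdf_nonpos l (by linarith) y hy',
      Mcdf_nonpos 1 one_pos y hy']
    have e1 : Real.exp (1/2 * y) = Real.exp (1 * y) * Real.exp (-y/2) := by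
      rw [← Real.exp_add]; ring_nf
    have e2 : Real.exp ((l-1/2) * y) = Real.exp (l * y) * Real.exp (-y/2) := by
      rw [← Real.exp_add]; ring_nf
    rw [e1, e2]; ring
  have h2 : IntegrableOn (fun y => (Mcdf l y - Mcdf 1 y) * Real.exp (|y| / 2)) (Set.Ioi 0) := by
    refine IntegrableOn.congr_fun (((integrableOn_exp_mul_Ioi (a := -(1/2)) (by norm_num) 0).sub
      (integrableOn_exp_mul_Ioi (a := -(l-1/2)) (by linarith) 0)).const_mul (1/2)) ?_ measurableSet_Ioi
    intro y hy
    have hy' : 0 ≤ y := le_of_lt hy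
    simp only [Pi.sub_apply, abs_of_nonneg hy', Mcdf_nonneg l (by linarith) y hy',
      Mcdf_nonneg 1 one_pos y hy']
    have e1 : Real.exp (-(1/2) * y) = Real.exp (-1 * y) * Real.exp (y/2) := by
      rw [← Real.exp_add]; ring_nf
    have e2 : Real.exp (-(l-1/2) * y) = Real.exp (-l * y) * Real.exp (y/2) := by
      rw [← Real.exp_add]; ring_nf
    rw [e1, e2]; ring
  rw [← integrableOn_univ, ← Set.Iic_union_Ioi (a := (0:ℝ))]
  exact h1.union h2

lemma D_integral (l : ℝ) (hl : 1 ≤ l) :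
    ∫ y, (Mcdf l y - Mcdf 1 y) * Real.exp (|y| / 2) = 0 := by
  have h := integral_neg_eq_self (fun y => (Mcdf l y - Mcdf 1 y) * Real.exp (|y| / 2)) volume
  have h2 : ∀ y, (Mcdf l (-y) - Mcdf 1 (-y)) * Real.exp (|-y| / 2) =
      -((Mcdf l y - Mcdf 1 y) * Real.exp (|y| / 2)) := by
    intro y
    rw [Mcdf_neg l (by linarith), Mcdf_neg 1 one_pos, abs_neg]; ring
  simp only [h2, integral_neg] at h
  linarith

lemma K_main (x : ℝ) (hx : 0 ≤ x) :
    Integrable (fun y => (1 - Mcdf 1 (max x y)) * Mcdf 1 (min x y) * Real.exp (|y| / 2)) ∧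
    Real.exp (|x| / 2) * ∫ y, (1 - Mcdf 1 (max x y)) * Mcdf 1 (min x y) * Real.exp (|y| / 2) ≤ 2 := by
  set f := fun y => (1 - Mcdf 1 (max x y)) * Mcdf 1 (min x y) * Real.exp (|y| / 2) with hf
  have c1 : Set.EqOn f (fun y => (Real.exp (-x) / 4) * Real.exp ((1/2) * y)) (Set.Iic 0) := by
    intro y hy
    have hy' : y ≤ 0 := hy
    simp only [hf, max_eq_left (hy'.trans hx), min_eq_right (hy'.trans hx), abs_of_nonpos hy',
      Mcdf_nonneg 1 one_pos x hx, Mcdf_nonpos 1 one_pos y hy']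
    have : Real.exp ((1/2) * y) = Real.exp (1 * y) * Real.exp (-y/2) := by
      rw [← Real.exp_add]; ring_nf
    rw [this]; ring_nf
  have c2 : Set.EqOn f (fun y => (Real.exp (-x) / 2) * (Real.exp (y / 2) - Real.exp (-(y/2)) / 2))
      (Set.Ioc 0 x) := by
    intro y hy
    simp only [hf, max_eq_left hy.2, min_eq_right hy.2, abs_of_pos hy.1,
      Mcdf_nonneg 1 one_pos x hx, Mcdf_nonneg 1 one_pos y hy.1.le]
    have : Real.exp (-(y/2)) = Real.exp (-1 * y) * Real.exp (y/2) := by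
      rw [← Real.exp_add]; ring_nf
    rw [this]; ring_nf
  have c3 : Set.EqOn f (fun y => ((1 - Real.exp (-x) / 2) / 2) * Real.exp (-(1/2) * y))
      (Set.Ioi x) := by
    intro y hy
    have hy' : x ≤ y := le_of_lt hy
    simp only [hf, max_eq_right hy', min_eq_left hy', abs_of_nonneg (hx.trans hy'),
      Mcdf_nonneg 1 one_pos x hx, Mcdf_nonneg 1 one_pos y (hx.trans hy')]
    have : Real.exp (-(1/2)*y) = Real.exp (-1 * y) * Real.exp (y/2) := by
      rw [← Real.exp_add]; ring_nf
    rw [this]; ring_nf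
  have i1 : IntegrableOn f (Set.Iic 0) :=
    IntegrableOn.congr_fun ((ii_expIic (1/2) (by norm_num) 0).const_mul _) c1.symm measurableSet_Iic
  have i2 : IntegrableOn f (Set.Ioc 0 x) :=
    IntegrableOn.congr_fun ((Continuous.integrableOn_Icc (by fun_prop)).mono_set
      Set.Ioc_subset_Icc_self) c2.symm measurableSet_Ioc
  have i3 : IntegrableOn f (Set.Ioi x) :=
    IntegrableOn.congr_fun ((integrableOn_exp_mul_Ioi (a := -(1/2)) (by norm_num) x).const_mul _)
      c3.symm measurableSet_Ioi
  have i12 : IntegrableOn f (Set.Iic x) := by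
    rw [← Set.Iic_union_Ioc_eq_Iic hx]; exact i1.union i2
  have i : Integrable f := by
    rw [← integrableOn_univ, ← Set.Iic_union_Ioi (a := x)]; exact i12.union i3
  refine ⟨i, ?_⟩
  rw [← setIntegral_univ, ← Set.Iic_union_Ioi (a := x), setIntegral_union
    (Set.Iic_disjoint_Ioi le_rfl) measurableSet_Ioi i12 i3,
    ← Set.Iic_union_Ioc_eq_Iic hx, setIntegral_union (Set.Iic_disjoint_Ioc le_rfl)
    measurableSet_Ioc i1 i2, setIntegral_congr_fun measurableSet_Iic c1,
    setIntegral_congr_fun measurableSet_Ioc c2, setIntegral_congr_fun measurableSet_Ioi c3,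
    integral_const_mul, integral_const_mul, integral_const_mul,
    integral_exp_mul_Iic (by norm_num), integral_exp_mul_Ioi (by norm_num),
    ← intervalIntegral.integral_of_le hx,
    intervalIntegral.integral_eq_sub_of_hasDerivAt
      (f := fun z => 2 * Real.exp (z/2) + Real.exp (-(z/2)))]
  · rw [abs_of_nonneg hx]
    have p := Real.exp_pos (-(x/2))
    have e1 : Real.exp (-x) = Real.exp (-(x/2)) ^ 2 := by
      rw [← Real.exp_nat_mul]; push_cast; ring_nf
    have e2 : Real.exp (x/2) = (Real.exp (-(x/2)))⁻¹ := by rw [← Real.exp_neg]; ring_nf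
    have e3 : Real.exp (-(1/2) * x) = Real.exp (-(x/2)) := by ring_nf
    rw [e1, e2, e3]
    generalize Real.exp (-(x/2)) = t at *
    simp only [mul_zero, zero_div, neg_zero, Real.exp_zero]
    have : 2 - t ≤ 2 := by linarith
    refine le_trans (le_of_eq ?_) this
    field_simp
    ring
  · intro z _
    have h1 := (((hasDerivAt_id z).div_const 2).exp).const_mul 2
    have h2 := ((hasDerivAt_id z).div_const 2).neg.exp
    refine HasDerivAt.congr_deriv (f := fun z => 2 * Real.exp (z/2) + Real.exp (-(z/2)))
      (h1.add h2) ?_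
    simp only [id, Pi.neg_apply]; ring
  · exact Continuous.intervalIntegrable (by fun_prop) _ _

lemma K_all (x : ℝ) :
    Integrable (fun y => (1 - Mcdf 1 (max x y)) * Mcdf 1 (min x y) * Real.exp (|y| / 2)) ∧
    Real.exp (|x| / 2) * ∫ y, (1 - Mcdf 1 (max x y)) * Mcdf 1 (min x y) * Real.exp (|y| / 2) ≤ 2 := by
  rcases le_total 0 x with h | h
  · exact K_main x h
  · obtain ⟨a, b⟩ := K_main (-x) (by linarith)
    have e : ∀ y, (1 - Mcdf 1 (max (-x) (-y))) * Mcdf 1 (min (-x) (-y)) * Real.exp (|-y| / 2)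
        = (1 - Mcdf 1 (max x y)) * Mcdf 1 (min x y) * Real.exp (|y| / 2) := by
      intro y
      rw [max_neg_neg, min_neg_neg, Mcdf_neg 1 one_pos, Mcdf_neg 1 one_pos, abs_neg]; ring
    have a' := a.comp_neg
    rw [← integral_neg_eq_self] at b
    simp only [e] at a' b
    rw [abs_neg] at b
    exact ⟨a', b⟩

/-- The pointwise bound `e^{|x|/2} ∫ Ω_{λ,1}(x,y) e^{|y|/2} dy ≤ 2`, the
integral being absolutely convergent. -/
theorem omega_pointwise_bound (lam : ℝ) (hlam : 1 ≤ lam) (x : ℝ) :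
    Integrable (fun y : ℝ => OmegaKer lam 1 x y * Real.exp (|y| / 2)) ∧
    Real.exp (|x| / 2) * ∫ y : ℝ, OmegaKer lam 1 x y * Real.exp (|y| / 2) ≤ 2 := by
  obtain ⟨a, b⟩ := K_all x
  have d := (D_integrable lam hlam).const_mul (Mcdf lam x - Mcdf 1 x)
  have e : (fun y : ℝ => OmegaKer lam 1 x y * Real.exp (|y| / 2)) = fun y =>
      (Mcdf lam x - Mcdf 1 x) * ((Mcdf lam y - Mcdf 1 y) * Real.exp (|y| / 2)) +
      (1 - Mcdf 1 (max x y)) * Mcdf 1 (min x y) * Real.exp (|y| / 2) := by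
    funext y; unfold OmegaKer; ring
  rw [e]
  refine ⟨d.add a, ?_⟩
  rw [integral_add d a, integral_const_mul, D_integral lam hlam, mul_zero, zero_add]
  exact b
end

section
/- Fix a ≥ b > 0. For any differentiable function f : ℝ → ℝ with ∫_ℝ |f(y)| e^{-a|y|} dy < ∞ and ∫_ℝ |f'(y)|² e^{-b|y|} dy < ∞, one has |f(0) − ⟨f⟩_a|² ≤ (1/(2a − b)) · (1/2) ∫_ℝ |f'(y)|² e^{-b|y|} dy. -/
open MeasureTheory Real

lemma half_line_s10 (a b : ℝ) (hb : 0 < b) (hab : b ≤ a)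
    (f : ℝ → ℝ) (hf : Differentiable ℝ f)
    (h1 : IntegrableOn (fun y : ℝ => f y * Real.exp (-a * y)) (Set.Ioi 0))
    (h2 : IntegrableOn (fun y : ℝ => (deriv f y) ^ 2 * Real.exp (-b * y)) (Set.Ioi 0)) :
    (f 0 - a * ∫ y in Set.Ioi (0:ℝ), f y * Real.exp (-a * y)) ^ 2
      ≤ (1 / (2 * a - b)) * ∫ y in Set.Ioi (0:ℝ), (deriv f y) ^ 2 * Real.exp (-b * y) := by
  have hc : 0 < 2 * a - b := by linarith
  have h3 : IntegrableOn (fun y : ℝ => Real.exp (-(2 * a - b) * y)) (Set.Ioi 0) :=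
    integrableOn_exp_mul_Ioi (by linarith) 0
  have h3v : ∫ y in Set.Ioi (0:ℝ), Real.exp (-(2 * a - b) * y) = 1 / (2 * a - b) := by
    rw [integral_exp_mul_Ioi (by linarith) 0]
    rw [mul_zero, Real.exp_zero, neg_div_neg_eq]
  have key : ∀ y, deriv f y * Real.exp (-a * y)
      = (deriv f y * Real.exp (-b / 2 * y)) * Real.exp (-(2 * a - b) / 2 * y) := by
    intro y
    rw [mul_assoc, ← Real.exp_add]; congr 2; ring
  have e1 : ∀ y, Real.exp (-b / 2 * y) ^ 2 = Real.exp (-b * y) := by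
    intro y
    rw [← Real.exp_nat_mul]; congr 1; push_cast; ring
  have e2 : ∀ y, Real.exp (-(2 * a - b) / 2 * y) ^ 2 = Real.exp (-(2 * a - b) * y) := by
    intro y
    rw [← Real.exp_nat_mul]; congr 1; push_cast; ring
  have h4 : IntegrableOn (fun y : ℝ => deriv f y * Real.exp (-a * y)) (Set.Ioi 0) := by
    refine Integrable.mono' (h2.add h3) ?_ ?_
    · exact ((measurable_deriv f).mul (by fun_prop)).aestronglyMeasurable
    · refine Filter.Eventually.of_forall fun y => ?_
      simp only [Pi.add_apply]
      rw [key, Real.norm_eq_abs, ← e1, ← e2, ← mul_pow]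
      generalize deriv f y * Real.exp (-b / 2 * y) = p
      generalize Real.exp (-(2 * a - b) / 2 * y) = q
      rw [abs_le]
      constructor <;> nlinarith [sq_nonneg (p + q), sq_nonneg (p - q), sq_nonneg p, sq_nonneg q]
  have hd : ∀ y, HasDerivAt (fun y => f y * Real.exp (-a * y))
      (deriv f y * Real.exp (-a * y) - a * (f y * Real.exp (-a * y))) y := by
    intro y
    have h0 : HasDerivAt (fun y : ℝ => -a * y) (-a) y := by
      simpa using (hasDerivAt_id y).const_mul (-a)
    have h := (hf y).hasDerivAt.fun_mul h0.exp
    have e : deriv f y * Real.exp (-a * y) - a * (f y * Real.exp (-a * y))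
      = deriv f y * Real.exp (-a * y) + f y * (Real.exp (-a * y) * -a) := by ring
    rw [e]; exact h
  have hF' : IntegrableOn (fun y => deriv f y * Real.exp (-a * y)
      - a * (f y * Real.exp (-a * y))) (Set.Ioi 0) := h4.sub (h1.const_mul a)
  have ht := tendsto_zero_of_hasDerivAt_of_integrableOn_Ioi (fun y _ => hd y) hF' h1
  have hI := integral_Ioi_of_hasDerivAt_of_tendsto' (a := 0) (fun y _ => hd y) hF' ht
  rw [integral_sub h4 (h1.const_mul a), integral_const_mul] at hI
  simp only [mul_zero, Real.exp_zero, mul_one] at hI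
  set S := ∫ y in Set.Ioi (0:ℝ), deriv f y * Real.exp (-a * y) with hS
  set U := ∫ y in Set.Ioi (0:ℝ), (deriv f y) ^ 2 * Real.exp (-b * y) with hU
  set t := S * (2 * a - b) with ht'
  have hpos : 0 ≤ ∫ y in Set.Ioi (0:ℝ), ((deriv f y) ^ 2 * Real.exp (-b * y)
      - 2 * t * (deriv f y * Real.exp (-a * y)) + t ^ 2 * Real.exp (-(2 * a - b) * y)) := by
    refine integral_nonneg fun y => ?_
    simp only [Pi.zero_apply]
    rw [key, ← e1, ← e2]
    nlinarith [sq_nonneg (deriv f y * Real.exp (-b / 2 * y) - t * Real.exp (-(2 * a - b) / 2 * y))]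
  have h24 : IntegrableOn (fun y : ℝ => (deriv f y) ^ 2 * Real.exp (-b * y)
      - 2 * t * (deriv f y * Real.exp (-a * y))) (Set.Ioi 0) := h2.sub (h4.const_mul _)
  rw [integral_add h24 (h3.const_mul _),
    integral_sub h2 (h4.const_mul _), integral_const_mul, integral_const_mul, h3v, ← hS, ← hU] at hpos
  have : f 0 - a * ∫ y in Set.Ioi (0:ℝ), f y * Real.exp (-a * y) = -S := by linarith
  rw [this, one_div, inv_mul_eq_div, le_div_iff₀ hc]
  have h5 : t ^ 2 * (1 / (2 * a - b)) = S ^ 2 * (2 * a - b) := by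
    rw [ht']; field_simp
  rw [h5, ht'] at hpos
  nlinarith

lemma split_int (g : ℝ → ℝ) (hg : Integrable g) :
    ∫ y, g y = (∫ y in Set.Ioi (0:ℝ), g y) + ∫ y in Set.Ioi (0:ℝ), g (-y) := by
  rw [integral_comp_neg_Ioi, neg_zero, add_comm]
  exact (intervalIntegral.integral_Iic_add_Ioi hg.integrableOn hg.integrableOn).symm

/-- Interpolation inequality: the deviation of `f(0)` from the `a`-weighted
average is controlled by the `b`-weighted Dirichlet energy. -/
theorem interpolation_inequality (a b : ℝ) (hb : 0 < b) (hab : b ≤ a)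
    (f : ℝ → ℝ) (hf : Differentiable ℝ f)
    (h1 : Integrable (fun y : ℝ => |f y| * Real.exp (-a * |y|)))
    (h2 : Integrable (fun y : ℝ => (deriv f y) ^ 2 * Real.exp (-b * |y|))) :
    (f 0 - wavg a f) ^ 2
      ≤ (1 / (2 * a - b)) *
          ((1 / 2) * ∫ y : ℝ, (deriv f y) ^ 2 * Real.exp (-b * |y|)) := by
  have h1' : Integrable (fun y : ℝ => f y * Real.exp (-a * |y|)) := by
    refine h1.mono' ?_ ?_
    · have := hf.continuous
      exact Continuous.aestronglyMeasurable (by fun_prop)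
    · exact Filter.Eventually.of_forall fun y => by simp
  have hab' : ∀ y ∈ Set.Ioi (0:ℝ), |y| = y := fun y hy => abs_of_pos hy
  have c1 : ∀ (g : ℝ → ℝ) (r : ℝ), Set.EqOn (fun y => g y * Real.exp (-r * |y|))
      (fun y => g y * Real.exp (-r * y)) (Set.Ioi 0) := by
    intro g r y hy
    simp only [hab' y hy]
  have hdn : ∀ y, deriv (fun x => f (-x)) y ^ 2 = deriv f (-y) ^ 2 := by
    intro y; rw [deriv_comp_neg]; ring
  have n1 := h1'.comp_neg
  have n2 := h2.comp_neg
  simp only [abs_neg] at n1 n2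
  have A := half_line_s10 a b hb hab f hf
    (h1'.integrableOn.congr_fun (c1 f a) measurableSet_Ioi)
    (h2.integrableOn.congr_fun (c1 (fun y => deriv f y ^ 2) b) measurableSet_Ioi)
  have B := half_line_s10 a b hb hab (fun x => f (-x)) (hf.comp differentiable_neg)
    (n1.integrableOn.congr_fun (c1 (fun x => f (-x)) a) measurableSet_Ioi)
    (by
      simp only [hdn]
      exact n2.integrableOn.congr_fun (c1 (fun y => deriv f (-y) ^ 2) b) measurableSet_Ioi)
  simp only [hdn, neg_zero] at B
  unfold wavg
  rw [split_int _ h1', split_int _ h2]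
  simp only [abs_neg]
  rw [setIntegral_congr_fun measurableSet_Ioi (c1 f a),
    setIntegral_congr_fun measurableSet_Ioi (c1 (fun x => f (-x)) a),
    setIntegral_congr_fun measurableSet_Ioi (c1 (fun y => deriv f y ^ 2) b),
    setIntegral_congr_fun measurableSet_Ioi (c1 (fun y => deriv f (-y) ^ 2) b)]
  set P := ∫ y in Set.Ioi (0:ℝ), f y * Real.exp (-a * y)
  set Q := ∫ y in Set.Ioi (0:ℝ), f (-y) * Real.exp (-a * y)
  have : (f 0 - a / 2 * (P + Q)) ^ 2 ≤ ((f 0 - a * P) ^ 2 + (f 0 - a * Q) ^ 2) / 2 := by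
    nlinarith [sq_nonneg ((f 0 - a * P) - (f 0 - a * Q))]
  refine this.trans ?_
  linarith
end

section
/- Let a > 0 and let f : ℝ → ℝ be differentiable such that y ↦ f'(y) e^{-a|y|} is integrable on ℝ and f(y) e^{-a|y|} → 0 as y → +∞ and as y → −∞. Then (1/2) ∫_ℝ sign(y) f'(y) e^{-a|y|} dy = ⟨f⟩_a − f(0), where sign(y) = 1 for y > 0 and sign(y) = −1 for y < 0. -/
open MeasureTheory Real Filter

/-- Singular integration by parts against the weight `sign(y) e^{-a|y|}`:
`(1/2) ∫ sign(y) f'(y) e^{-a|y|} dy = ⟨f⟩_a − f(0)`. -/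
theorem singular_integration_by_parts (a : ℝ) (ha : 0 < a)
    (f : ℝ → ℝ) (hf : Differentiable ℝ f)
    (h1 : Integrable (fun y : ℝ => deriv f y * Real.exp (-a * |y|)))
    (h2 : Integrable (fun y : ℝ => f y * Real.exp (-a * |y|)))
    (htop : Tendsto (fun y : ℝ => f y * Real.exp (-a * |y|)) atTop (nhds 0))
    (hbot : Tendsto (fun y : ℝ => f y * Real.exp (-a * |y|)) atBot (nhds 0)) :
    (1 / 2) * ∫ y : ℝ, Real.sign y * deriv f y * Real.exp (-a * |y|)
      = wavg a f - f 0 := by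
  have hc : Continuous (fun y : ℝ => f y * Real.exp (-a * |y|)) := by
    have := hf.continuous
    fun_prop
  have hR : ∫ y in Set.Ioi (0:ℝ), (deriv f y * Real.exp (-a * |y|)
      - a * (f y * Real.exp (-a * |y|))) = 0 - f 0 * Real.exp (-a * |(0:ℝ)|) := by
    refine integral_Ioi_of_hasDerivAt_of_tendsto
      (f := fun y : ℝ => f y * Real.exp (-a * |y|)) hc.continuousWithinAt ?_
      (h1.sub (h2.const_mul a)).integrableOn htop
    intro x hx
    have hx : 0 < x := hx
    have hd : HasDerivAt (fun y : ℝ => f y * Real.exp (-a * y))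
        (deriv f x * Real.exp (-a * x) + f x * (Real.exp (-a * x) * (-a * 1))) x :=
      (hf x).hasDerivAt.mul (((hasDerivAt_id x).const_mul (-a)).exp)
    rw [abs_of_pos hx]
    refine (hd.congr_of_eventuallyEq ?_).congr_deriv (by ring)
    filter_upwards [lt_mem_nhds hx] with y hy
    rw [abs_of_pos hy]
  have hL : ∫ y in Set.Iic (0:ℝ), (deriv f y * Real.exp (-a * |y|)
      + a * (f y * Real.exp (-a * |y|))) = f 0 * Real.exp (-a * |(0:ℝ)|) - 0 := by
    refine integral_Iic_of_hasDerivAt_of_tendsto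
      (f := fun y : ℝ => f y * Real.exp (-a * |y|)) hc.continuousWithinAt ?_
      (h1.add (h2.const_mul a)).integrableOn hbot
    intro x hx
    have hx : x < 0 := hx
    have hd : HasDerivAt (fun y : ℝ => f y * Real.exp (a * y))
        (deriv f x * Real.exp (a * x) + f x * (Real.exp (a * x) * (a * 1))) x :=
      (hf x).hasDerivAt.mul (((hasDerivAt_id x).const_mul a).exp)
    rw [abs_of_neg hx, neg_mul_neg]
    refine (hd.congr_of_eventuallyEq ?_).congr_deriv (by ring)
    filter_upwards [gt_mem_nhds hx] with y hy
    rw [abs_of_neg hy, neg_mul_neg]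
  rw [integral_sub h1.integrableOn (h2.const_mul a).integrableOn, integral_const_mul] at hR
  rw [integral_add h1.integrableOn (h2.const_mul a).integrableOn, integral_const_mul] at hL
  have eR : Set.EqOn (fun y : ℝ => deriv f y * Real.exp (-a * |y|))
      (fun y : ℝ => Real.sign y * deriv f y * Real.exp (-a * |y|)) (Set.Ioi 0) := by
    intro y hy
    simp [Real.sign_of_pos hy]
  have eL : Set.EqOn (fun y : ℝ => -(deriv f y * Real.exp (-a * |y|)))
      (fun y : ℝ => Real.sign y * deriv f y * Real.exp (-a * |y|)) (Set.Iio 0) := by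
    intro y hy
    simp [Real.sign_of_neg hy]
  have iR := (h1.integrableOn (s := Set.Ioi 0)).congr_fun eR measurableSet_Ioi
  have iL := (h1.neg.integrableOn (s := Set.Iio 0)).congr_fun eL measurableSet_Iio
  have iL' := (integrableOn_Iic_iff_integrableOn_Iio (by finiteness)).2 iL
  unfold wavg
  rw [← intervalIntegral.integral_Iic_add_Ioi iL' iR,
    ← intervalIntegral.integral_Iic_add_Ioi (b := 0) h2.integrableOn h2.integrableOn,
    integral_Iic_eq_integral_Iio, ← setIntegral_congr_fun measurableSet_Ioi eR,
    ← setIntegral_congr_fun measurableSet_Iio eL, integral_neg,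
    ← integral_Iic_eq_integral_Iio]
  simp only [abs_zero, mul_zero, Real.exp_zero, mul_one] at hR hL
  linarith
end

section
/- Let χ > 0 and let w : ℝ → ℝ be continuously differentiable with ∫_ℝ w(y)² e^{-χ|y|} dy < ∞ and ∫_ℝ w'(y)² e^{-χ|y|} dy < ∞. Then ∫_ℝ (w'(y) − χ · sign(y) · w(y))² e^{-χ|y|} dy = ∫_ℝ w'(y)² e^{-χ|y|} dy + 2χ w(0)², where sign(y) = 1 for y > 0 and sign(y) = −1 for y < 0. -/
open MeasureTheory Real

/-- Weighted H¹ dissipation identity: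
`∫ (w' − χ sign(y) w)² e^{-χ|y|} dy = ∫ (w')² e^{-χ|y|} dy + 2χ w(0)²`. -/
theorem dissipation_identity (chi : ℝ) (hchi : 0 < chi)
    (w : ℝ → ℝ) (hw : ContDiff ℝ 1 w)
    (h1 : Integrable (fun y : ℝ => (w y) ^ 2 * Real.exp (-chi * |y|)))
    (h2 : Integrable (fun y : ℝ => (deriv w y) ^ 2 * Real.exp (-chi * |y|))) :
    ∫ y : ℝ, (deriv w y - chi * Real.sign y * w y) ^ 2 * Real.exp (-chi * |y|)
      = (∫ y : ℝ, (deriv w y) ^ 2 * Real.exp (-chi * |y|)) + 2 * chi * (w 0) ^ 2 := by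
  have hc : Continuous w := hw.continuous
  have hc' : Continuous (deriv w) := hw.continuous_deriv le_rfl
  have hd : ∀ y, HasDerivAt w (deriv w y) y := fun y =>
    (hw.differentiable (by norm_num) y).hasDerivAt
  have h3 : Integrable (fun y : ℝ => w y * deriv w y * Real.exp (-chi * |y|)) := by
    refine (h1.add h2).mono' (by fun_prop) (Filter.Eventually.of_forall fun y => ?_)
    have he := Real.exp_pos (-chi * |y|)
    simp only [Pi.add_apply]
    rw [Real.norm_eq_abs, abs_mul, abs_of_pos he, ← add_mul]
    refine mul_le_mul_of_nonneg_right ?_ he.le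
    rw [abs_le]
    constructor <;> nlinarith [sq_nonneg (w y + deriv w y), sq_nonneg (w y - deriv w y),
      sq_nonneg (w y), sq_nonneg (deriv w y)]
  have hG : ∀ s y : ℝ, HasDerivAt (fun y => (w y) ^ 2 * Real.exp (s * y))
      (2 * (w y * deriv w y * Real.exp (s * y)) + s * ((w y) ^ 2 * Real.exp (s * y))) y := by
    intro s y
    have := ((hd y).pow 2).mul (((hasDerivAt_id y).const_mul s).exp)
    refine this.congr_deriv ?_
    simp
    ring
  have hint : ∀ s : ℝ, Integrable (fun y : ℝ => 2 * (w y * deriv w y * Real.exp (-chi * |y|))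
      + s * ((w y) ^ 2 * Real.exp (-chi * |y|))) := fun s =>
    (h3.const_mul 2).add (h1.const_mul s)
  -- right half line
  have eR : ∀ y ∈ Set.Ioi (0:ℝ), -chi * |y| = -chi * y := fun y hy => by
    rw [abs_of_pos hy]
  have eL : ∀ y ∈ Set.Iic (0:ℝ), -chi * |y| = chi * y := fun y hy => by
    rw [abs_of_nonpos hy]; ring
  have iR : IntegrableOn (fun y : ℝ => 2 * (w y * deriv w y * Real.exp (-chi * y))
      + (-chi) * ((w y) ^ 2 * Real.exp (-chi * y))) (Set.Ioi 0) :=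
    (hint (-chi)).integrableOn.congr_fun (fun y hy => by simp only [eR y hy]) measurableSet_Ioi
  have iL : IntegrableOn (fun y : ℝ => 2 * (w y * deriv w y * Real.exp (chi * y))
      + chi * ((w y) ^ 2 * Real.exp (chi * y))) (Set.Iic 0) :=
    (hint chi).integrableOn.congr_fun (fun y hy => by simp only [eL y hy]) measurableSet_Iic
  have jR : IntegrableOn (fun y : ℝ => (w y) ^ 2 * Real.exp (-chi * y)) (Set.Ioi 0) :=
    h1.integrableOn.congr_fun (fun y hy => by simp only [eR y hy]) measurableSet_Ioi
  have jL : IntegrableOn (fun y : ℝ => (w y) ^ 2 * Real.exp (chi * y)) (Set.Iic 0) :=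
    h1.integrableOn.congr_fun (fun y hy => by simp only [eL y hy]) measurableSet_Iic
  have kR := integral_Ioi_of_hasDerivAt_of_tendsto' (fun y _ => hG (-chi) y) iR
    (tendsto_zero_of_hasDerivAt_of_integrableOn_Ioi (fun y _ => hG (-chi) y) iR jR)
  have kL := integral_Iic_of_hasDerivAt_of_tendsto' (fun y _ => hG chi y) iL
    (tendsto_zero_of_hasDerivAt_of_integrableOn_Iic (fun y _ => hG chi y) iL jL)
  simp only [mul_zero, Real.exp_zero, mul_one, zero_sub, sub_zero] at kR kL
  have aL : ∀ᵐ y ∂(volume.restrict (Set.Iic (0:ℝ))),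
      (deriv w y) ^ 2 * Real.exp (-chi * |y|)
        + chi * (2 * (w y * deriv w y * Real.exp (chi * y))
          + chi * ((w y) ^ 2 * Real.exp (chi * y)))
      = (deriv w y - chi * Real.sign y * w y) ^ 2 * Real.exp (-chi * |y|) := by
    rw [← Measure.restrict_congr_set (Iio_ae_eq_Iic (a := (0:ℝ)) (μ := volume))]
    refine (ae_restrict_iff' measurableSet_Iio).2 (Filter.Eventually.of_forall fun y hy => ?_)
    rw [eL y (Set.Iio_subset_Iic_self hy), Real.sign_of_neg hy]; ring
  have aR : ∀ᵐ y ∂(volume.restrict (Set.Ioi (0:ℝ))),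
      (deriv w y) ^ 2 * Real.exp (-chi * |y|)
        + (-chi) * (2 * (w y * deriv w y * Real.exp (-chi * y))
          + (-chi) * ((w y) ^ 2 * Real.exp (-chi * y)))
      = (deriv w y - chi * Real.sign y * w y) ^ 2 * Real.exp (-chi * |y|) := by
    refine (ae_restrict_iff' measurableSet_Ioi).2 (Filter.Eventually.of_forall fun y hy => ?_)
    rw [eR y hy, Real.sign_of_pos hy]; ring
  have fL := (h2.integrableOn (s := Set.Iic 0)).add (iL.const_mul chi)
  have fR := (h2.integrableOn (s := Set.Ioi 0)).add (iR.const_mul (-chi))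
  have gL := fL.congr aL
  have gR := fR.congr aR
  rw [← intervalIntegral.integral_Iic_add_Ioi gL gR,
    ← intervalIntegral.integral_Iic_add_Ioi (h2.integrableOn (s := Set.Iic 0))
      (h2.integrableOn (s := Set.Ioi 0)),
    ← integral_congr_ae aL, ← integral_congr_ae aR,
    integral_add h2.integrableOn (iL.const_mul chi),
    integral_add h2.integrableOn (iR.const_mul (-chi)),
    integral_const_mul, integral_const_mul, kL, kR]
  ring
end

section
/- Let χ > 0 and let w : ℝ → ℝ be continuously differentiable with ∫_ℝ w(y)² e^{-χ|y|} dy < ∞ and ∫_ℝ w'(y)² e^{-χ|y|} dy < ∞. Then w(0)² ≤ (∫_ℝ w(y)² e^{-χ|y|} dy)^{1/2} · (∫_ℝ w'(y)² e^{-χ|y|} dy)^{1/2} + (χ/2) ∫_ℝ w(y)² e^{-χ|y|} dy. -/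
open MeasureTheory Real

/-- Pointwise bound on the value at the origin:
`w(0)² ≤ (∫ w² e^{-χ|y|})^{1/2} (∫ (w')² e^{-χ|y|})^{1/2} + (χ/2) ∫ w² e^{-χ|y|}`. -/
theorem origin_pointwise_bound (chi : ℝ) (hchi : 0 < chi)
    (w : ℝ → ℝ) (hw : ContDiff ℝ 1 w)
    (h1 : Integrable (fun y : ℝ => (w y) ^ 2 * Real.exp (-chi * |y|)))
    (h2 : Integrable (fun y : ℝ => (deriv w y) ^ 2 * Real.exp (-chi * |y|))) :
    (w 0) ^ 2
      ≤ Real.sqrt (∫ y : ℝ, (w y) ^ 2 * Real.exp (-chi * |y|)) *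
          Real.sqrt (∫ y : ℝ, (deriv w y) ^ 2 * Real.exp (-chi * |y|))
        + (chi / 2) * ∫ y : ℝ, (w y) ^ 2 * Real.exp (-chi * |y|) := by
  have hc : Continuous w := hw.continuous
  have hc' : Continuous (deriv w) := hw.continuous_deriv le_rfl
  have hd : ∀ y, HasDerivAt w (deriv w y) y := fun y =>
    ((hw.differentiable one_ne_zero) y).hasDerivAt
  have hQ : Integrable (fun y : ℝ => w y * deriv w y * Real.exp (-chi * |y|)) := by
    refine (h1.add h2).mono' (by fun_prop) (Filter.Eventually.of_forall fun y => ?_)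
    have hE := Real.exp_pos (-chi * |y|)
    simp only [Pi.add_apply, Real.norm_eq_abs]
    rw [abs_mul, abs_of_pos hE, ← add_mul]
    refine mul_le_mul_of_nonneg_right ?_ hE.le
    rw [abs_le]
    constructor <;> nlinarith [sq_nonneg (w y + deriv w y), sq_nonneg (w y - deriv w y), sq_nonneg (w y), sq_nonneg (deriv w y)]
  have hP : Integrable (fun y : ℝ => |w y * deriv w y| * Real.exp (-chi * |y|)) := by
    refine hQ.abs.congr (Filter.Eventually.of_forall fun y => ?_)
    simp only [abs_mul, abs_of_pos (Real.exp_pos (-chi * |y|))]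
  have hA0 : 0 ≤ ∫ y : ℝ, (w y) ^ 2 * Real.exp (-chi * |y|) :=
    integral_nonneg fun y => by positivity
  have hB0 : 0 ≤ ∫ y : ℝ, (deriv w y) ^ 2 * Real.exp (-chi * |y|) :=
    integral_nonneg fun y => by positivity
  have hCS : (∫ y : ℝ, |w y * deriv w y| * Real.exp (-chi * |y|)) ≤
      Real.sqrt (∫ y : ℝ, (w y) ^ 2 * Real.exp (-chi * |y|)) *
          Real.sqrt (∫ y : ℝ, (deriv w y) ^ 2 * Real.exp (-chi * |y|)) := by
    rw [← Real.sqrt_mul hA0]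
    apply Real.le_sqrt_of_sq_le
    have key : ∀ t : ℝ, 0 ≤ (∫ y : ℝ, (w y) ^ 2 * Real.exp (-chi * |y|)) * (t * t)
        + (-2 * ∫ y : ℝ, |w y * deriv w y| * Real.exp (-chi * |y|)) * t
        + ∫ y : ℝ, (deriv w y) ^ 2 * Real.exp (-chi * |y|) := by
      intro t
      have e : (∫ y : ℝ, (|w y| * t - |deriv w y|) ^ 2 * Real.exp (-chi * |y|)) =
        (t * t) * (∫ y : ℝ, (w y) ^ 2 * Real.exp (-chi * |y|))
        + (-2 * t) * (∫ y : ℝ, |w y * deriv w y| * Real.exp (-chi * |y|))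
        + ∫ y : ℝ, (deriv w y) ^ 2 * Real.exp (-chi * |y|) := by
        have hs : Integrable (fun y : ℝ => (t * t) * ((w y) ^ 2 * Real.exp (-chi * |y|))
            + (-2 * t) * (|w y * deriv w y| * Real.exp (-chi * |y|))) :=
          (h1.const_mul _).add (hP.const_mul _)
        rw [← integral_const_mul, ← integral_const_mul,
          ← integral_add (h1.const_mul _) (hP.const_mul _),
          ← integral_add hs h2]
        congr 1
        funext y
        rw [abs_mul, ← sq_abs (w y), ← sq_abs (deriv w y)]
        ring
      have : 0 ≤ ∫ y : ℝ, (|w y| * t - |deriv w y|) ^ 2 * Real.exp (-chi * |y|) :=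
        integral_nonneg fun y => by positivity
      linarith
    have := discrim_le_zero key
    unfold discrim at this
    nlinarith
  have hG : Integrable (fun y : ℝ => 2 * (|w y * deriv w y| * Real.exp (-chi * |y|))
      + chi * ((w y) ^ 2 * Real.exp (-chi * |y|))) := (hP.const_mul _).add (h1.const_mul _)
  have hR : (w 0) ^ 2 ≤ ∫ y in Set.Ioi (0:ℝ), (2 * (|w y * deriv w y| * Real.exp (-chi * |y|))
      + chi * ((w y) ^ 2 * Real.exp (-chi * |y|))) := by
    have hder : ∀ y ∈ Set.Ici (0:ℝ), HasDerivAt (fun y => w y ^ 2 * Real.exp (-chi * y))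
        (2 * (w y * deriv w y * Real.exp (-chi * |y|))
          + (-chi) * (w y ^ 2 * Real.exp (-chi * |y|))) y := by
      intro y hy
      rw [abs_of_nonneg hy]
      have := ((hd y).pow 2).mul (((hasDerivAt_id y).const_mul (-chi)).exp)
      refine HasDerivAt.congr_deriv this ?_
      simp
      ring
    have hi : IntegrableOn (fun y => 2 * (w y * deriv w y * Real.exp (-chi * |y|))
          + (-chi) * (w y ^ 2 * Real.exp (-chi * |y|))) (Set.Ioi (0:ℝ)) :=
      ((hQ.const_mul _).add (h1.const_mul _)).integrableOn
    have hf : IntegrableOn (fun y => w y ^ 2 * Real.exp (-chi * y)) (Set.Ioi (0:ℝ)) := by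
      refine h1.integrableOn.congr_fun (fun y hy => ?_) measurableSet_Ioi
      simp only [abs_of_pos (Set.mem_Ioi.1 hy)]
    have ht := tendsto_zero_of_hasDerivAt_of_integrableOn_Ioi
      (fun y hy => hder y (Set.Ioi_subset_Ici_self hy)) hi hf
    have := integral_Ioi_of_hasDerivAt_of_tendsto' hder hi ht
    have e : (w 0) ^ 2 = ∫ y in Set.Ioi (0:ℝ), -(2 * (w y * deriv w y * Real.exp (-chi * |y|))
          + (-chi) * (w y ^ 2 * Real.exp (-chi * |y|))) := by
      rw [integral_neg, this]; simp
    rw [e]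
    refine integral_mono hi.neg hG.integrableOn fun y => ?_
    have := mul_le_mul_of_nonneg_right (neg_abs_le (w y * deriv w y))
      (Real.exp_pos (-chi * |y|)).le
    simp only [Pi.neg_apply]
    linarith
  have hL : (w 0) ^ 2 ≤ ∫ y in Set.Iic (0:ℝ), (2 * (|w y * deriv w y| * Real.exp (-chi * |y|))
      + chi * ((w y) ^ 2 * Real.exp (-chi * |y|))) := by
    have hder : ∀ y ∈ Set.Iic (0:ℝ), HasDerivAt (fun y => w y ^ 2 * Real.exp (chi * y))
        (2 * (w y * deriv w y * Real.exp (-chi * |y|))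
          + chi * (w y ^ 2 * Real.exp (-chi * |y|))) y := by
      intro y hy
      rw [abs_of_nonpos hy, neg_mul_neg]
      have := ((hd y).pow 2).mul (((hasDerivAt_id y).const_mul chi).exp)
      refine HasDerivAt.congr_deriv this ?_
      simp
      ring
    have hi : IntegrableOn (fun y => 2 * (w y * deriv w y * Real.exp (-chi * |y|))
          + chi * (w y ^ 2 * Real.exp (-chi * |y|))) (Set.Iic (0:ℝ)) :=
      ((hQ.const_mul _).add (h1.const_mul _)).integrableOn
    have hf : IntegrableOn (fun y => w y ^ 2 * Real.exp (chi * y)) (Set.Iic (0:ℝ)) := by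
      refine h1.integrableOn.congr_fun (fun y hy => ?_) measurableSet_Iic
      simp only [abs_of_nonpos (Set.mem_Iic.1 hy), neg_mul_neg]
    have ht := tendsto_zero_of_hasDerivAt_of_integrableOn_Iic hder hi hf
    have := integral_Iic_of_hasDerivAt_of_tendsto' hder hi ht
    have e : (w 0) ^ 2 = ∫ y in Set.Iic (0:ℝ), (2 * (w y * deriv w y * Real.exp (-chi * |y|))
          + chi * (w y ^ 2 * Real.exp (-chi * |y|))) := by
      rw [this]; simp
    rw [e]
    refine integral_mono hi hG.integrableOn fun y => ?_
    have := mul_le_mul_of_nonneg_right (le_abs_self (w y * deriv w y))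
      (Real.exp_pos (-chi * |y|)).le
    simp only
    linarith
  have hS := intervalIntegral.integral_Iic_add_Ioi (b := (0:ℝ)) hG.integrableOn hG.integrableOn
  rw [integral_add (hP.const_mul _) (h1.const_mul _), integral_const_mul,
    integral_const_mul] at hS
  linarith
end

section
/- Let χ > 0 and v₀ > 0, and let φ : ℝ → ℝ be continuous, odd and non-increasing. Define Φ(x) = ∫_0^x φ(t) dt and f(r) = −(1/(2v₀)) ∫_{−v₀}^{v₀} Φ(v r) dv. Assume f(1/χ) > 0. Then there exists a differentiable, strictly decreasing function Z : ℝ → ℝ such that Z'(x) = f(Z(x)) − f(1/χ) for all x ∈ ℝ, with lim_{x → −∞} Z(x) = 1/χ and lim_{x → +∞} Z(x) = −1/χ. -/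
open MeasureTheory Real Filter

lemma hsp_flow (h : ℝ → ℝ) (hc : Continuous h) (c : ℝ) (c0 : 0 < c) (hh : ∀ y, c ≤ h y) :
    ∃ Y : ℝ → ℝ, StrictMono Y ∧ (∀ x, HasDerivAt Y (h (Y x))⁻¹ x) ∧
      Tendsto Y atTop atTop ∧ Tendsto Y atBot atBot := by
  set H : ℝ → ℝ := fun y => ∫ t in (0:ℝ)..y, h t with hH
  have hd : ∀ y, HasDerivAt H (h y) y := fun y => hc.integral_hasStrictDerivAt 0 y |>.hasDerivAt
  have hpos : ∀ y, 0 < h y := fun y => c0.trans_le (hh y)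
  have hsm : StrictMono H := strictMono_of_deriv_pos fun y => by rw [(hd y).deriv]; exact hpos y
  have hcont : Continuous H := continuous_iff_continuousAt.2 fun y => (hd y).continuousAt
  have hK : Monotone (fun y => H y - c * y) := by
    have hk : ∀ y, HasDerivAt (fun y => H y - c * y) (h y - c * 1) y := fun y =>
      (hd y).sub ((hasDerivAt_id y).const_mul c)
    apply monotone_of_deriv_nonneg (fun y => (hk y).differentiableAt)
    intro y
    rw [(hk y).deriv]
    linarith [hh y]
  have H0 : H 0 = 0 := by simp [hH]
  have htop : Tendsto H atTop atTop := by
    refine tendsto_atTop_mono' _ ?_ (tendsto_id.const_mul_atTop c0)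
    filter_upwards [eventually_ge_atTop 0] with y hy
    have := hK hy
    simp only [H0] at this
    simp only [id]
    linarith
  have hbot : Tendsto H atBot atBot := by
    refine tendsto_atBot_mono' _ ?_ (tendsto_id.const_mul_atBot c0)
    filter_upwards [eventually_le_atBot 0] with y hy
    have := hK hy
    simp only [H0] at this
    simp only [id]
    linarith
  let e := hsm.orderIsoOfSurjective H (hcont.surjective htop hbot)
  have he : ∀ x, H (e.symm x) = x := fun x => e.apply_symm_apply x
  refine ⟨e.symm, e.symm.strictMono, fun x => ?_, e.symm.tendsto_atTop, e.symm.tendsto_atBot⟩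
  exact HasDerivAt.of_local_left_inverse e.symm.continuous.continuousAt (hd _) (hpos _).ne'
    (Eventually.of_forall he)

lemma hsp_convex (f : ℝ → ℝ) (hf : ConvexOn ℝ Set.univ f) (heven : ∀ x, f (-x) = f x)
    (hf0 : f 0 = 0) (a : ℝ) (ha : 0 < a) (hpos : 0 < f a) :
    ∃ Z : ℝ → ℝ, Differentiable ℝ Z ∧ StrictAnti Z ∧
      (∀ x : ℝ, deriv Z x = f (Z x) - f a) ∧
      Tendsto Z atBot (nhds a) ∧ Tendsto Z atTop (nhds (-a)) := by
  have hcont : Continuous f := by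
    have := hf.continuousOn isOpen_univ
    exact continuousOn_univ.1 this
  have hlt0 : ∀ z, 0 ≤ z → z < a → f z < f a := by
    intro z hz hza
    have h1 := hf.2 (Set.mem_univ a) (Set.mem_univ 0)
      (show 0 ≤ z / a by positivity)
      (show 0 ≤ 1 - z / a by rw [sub_nonneg, div_le_one ha]; exact hza.le) (by ring)
    have h2 : z / a * a = z := by field_simp
    simp only [smul_eq_mul, mul_zero, add_zero, hf0, h2] at h1
    have h3 : z / a < 1 := by rwa [div_lt_one ha]
    nlinarith
  have hlt : ∀ z, -a < z → z < a → f z < f a := by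
    intro z h1 h2
    rcases le_total 0 z with h | h
    · exact hlt0 z h h2
    · rw [← heven]; exact hlt0 (-z) (by linarith) (by linarith)
  set L := (f (2 * a) - f a) / (2 * a - a) with hL
  have hub : ∀ z, z < a → f a - f z ≤ L * (a - z) := by
    intro z hz
    have := hf.slope_mono_adjacent (Set.mem_univ z) (Set.mem_univ (2 * a)) hz (by linarith)
    rwa [div_le_iff₀ (by linarith)] at this
  have hub' : ∀ z, -a < z → f a - f z ≤ L * (a + z) := by
    intro z hz
    have := hub (-z) (by linarith)
    rw [heven] at this
    linarith
  have hLpos : 0 < L := by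
    have := hub 0 ha
    rw [hf0] at this
    by_contra hcon
    nlinarith
  set σ := Real.sigmoid with hσ
  have s0 : ∀ y, 0 < σ y := Real.sigmoid_pos
  have s1 : ∀ y, σ y < 1 := Real.sigmoid_lt_one
  have sc : Continuous σ := continuous_sigmoid
  let z : ℝ → ℝ := fun y => a * (2 * σ y - 1)
  have zc : Continuous z := by fun_prop
  have z1 : ∀ y, z y < a := fun y => by
    have := mul_pos ha (sub_pos.2 (s1 y)); simp only [z]; nlinarith
  have z2 : ∀ y, -a < z y := fun y => by
    have := mul_pos ha (s0 y); simp only [z]; nlinarith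
  have dpos : ∀ y, 0 < f a - f (z y) := fun y => sub_pos.2 (hlt _ (z2 y) (z1 y))
  let h : ℝ → ℝ := fun y => (2 * a * (σ y * (1 - σ y))) / (f a - f (z y))
  have hc : Continuous h := by
    apply Continuous.div (by fun_prop) (by fun_prop) fun y => (dpos y).ne'
  have hlow : ∀ y, 1 / (2 * L) ≤ h y := by
    intro y
    simp only [h]
    rw [div_le_div_iff₀ (by positivity) (dpos y)]
    have e1 := hub _ (z1 y)
    have e2 := hub' _ (z2 y)
    have e1' : L * (a - z y) = 2 * (L * a) * (1 - σ y) := by simp only [z]; ring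
    have e2' : L * (a + z y) = 2 * (L * a) * σ y := by simp only [z]; ring
    have hLa : 0 < L * a := mul_pos hLpos ha
    rw [e1'] at e1
    rw [e2'] at e2
    have m1 := mul_le_mul_of_nonneg_left e1 (s0 y).le
    have m2 := mul_le_mul_of_nonneg_left e2 (sub_pos.2 (s1 y)).le
    nlinarith
  obtain ⟨Y, Ym, Yd, Yt, Yb⟩ := hsp_flow h hc _ (by positivity) hlow
  have hD : ∀ x, HasDerivAt (fun x => z (Y (-x))) (f (z (Y (-x))) - f a) x := by
    intro x
    have d1 : HasDerivAt (fun x => Y (-x)) ((h (Y (-x)))⁻¹ * (-1)) x :=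
      (Yd (-x)).comp x (hasDerivAt_neg x)
    have d2 : HasDerivAt z (a * (2 * (σ (Y (-x)) * (1 - σ (Y (-x)))))) (Y (-x)) :=
      (((Real.hasDerivAt_sigmoid (Y (-x))).const_mul 2).sub_const 1).const_mul a
    have d3 := d2.comp x d1
    refine d3.congr_deriv ?_
    have := s0 (Y (-x))
    have := sub_pos.2 (s1 (Y (-x)))
    have := dpos (Y (-x))
    simp only [h]
    field_simp
    ring
  have zm : StrictMono z := fun p q hpq => by
    have := Real.sigmoid_strictMono hpq
    simp only [z]
    have := mul_lt_mul_of_pos_left this ha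
    simp only [hσ]
    nlinarith
  refine ⟨fun x => z (Y (-x)), fun x => (hD x).differentiableAt, ?_, fun x => (hD x).deriv, ?_, ?_⟩
  · intro p q hpq
    exact zm (Ym (neg_lt_neg hpq))
  · have t : Tendsto z atTop (nhds (a * (2 * 1 - 1))) :=
      ((Real.tendsto_sigmoid_atTop.const_mul 2).sub_const 1).const_mul a
    have e : a * (2 * 1 - 1) = a := by ring
    rw [e] at t
    exact t.comp (Yt.comp tendsto_neg_atBot_atTop)
  · have t : Tendsto z atBot (nhds (a * (2 * 0 - 1))) :=
      ((Real.tendsto_sigmoid_atBot.const_mul 2).sub_const 1).const_mul a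
    have e : a * (2 * 0 - 1) = -a := by ring
    rw [e] at t
    exact t.comp (Yb.comp tendsto_neg_atTop_atBot)

/-- Existence of the heteroclinic stationary profile for the `α = 0`
chemotaxis model: a strictly decreasing solution of `Z' = f(Z) − f(1/χ)`
connecting `1/χ` at `−∞` to `−1/χ` at `+∞`. -/
theorem heteroclinic_stationary_profile (chi v0 : ℝ) (hchi : 0 < chi) (hv0 : 0 < v0)
    (φ : ℝ → ℝ) (hφc : Continuous φ) (hφodd : ∀ x : ℝ, φ (-x) = -φ x)
    (hφmono : Antitone φ)
    (f : ℝ → ℝ)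
    (hf : ∀ r : ℝ, f r = -(1 / (2 * v0)) *
        ∫ v in (-v0)..v0, (∫ t in (0:ℝ)..(v * r), φ t))
    (hpos : 0 < f (1 / chi)) :
    ∃ Z : ℝ → ℝ, Differentiable ℝ Z ∧ StrictAnti Z ∧
      (∀ x : ℝ, deriv Z x = f (Z x) - f (1 / chi)) ∧
      Tendsto Z atBot (nhds (1 / chi)) ∧
      Tendsto Z atTop (nhds (-(1 / chi))) := by
  set P : ℝ → ℝ := fun x => ∫ t in (0:ℝ)..x, φ t with hP
  have hd : ∀ y, HasDerivAt P (φ y) y := fun y => hφc.integral_hasStrictDerivAt 0 y |>.hasDerivAt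
  have hPc : Continuous P := continuous_iff_continuousAt.2 fun y => (hd y).continuousAt
  have hconc : ConcaveOn ℝ Set.univ P := by
    apply Antitone.concaveOn_univ_of_deriv (fun y => (hd y).differentiableAt)
    have : deriv P = φ := funext fun y => (hd y).deriv
    rwa [this]
  have hPeven : ∀ x, P (-x) = P x := by
    intro x
    have h1 := intervalIntegral.integral_comp_neg (a := 0) (b := x) φ
    simp only [hφodd, neg_zero, intervalIntegral.integral_neg] at h1
    simp only [hP]
    rw [intervalIntegral.integral_symm, ← h1, neg_neg]
  have hf' : ∀ r, f r = -(1 / (2 * v0)) * ∫ v in (-v0)..v0, P (v * r) := hf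
  have hint : ∀ r, IntervalIntegrable (fun v => P (v * r)) volume (-v0) v0 := fun r =>
    Continuous.intervalIntegrable (by fun_prop) _ _
  apply hsp_convex f ?_ ?_ ?_ (1 / chi) (by positivity) hpos
  · refine ⟨convex_univ, fun x _ y _ p q hp hq hpq => ?_⟩
    have key : p * (∫ v in (-v0)..v0, P (v * x)) + q * (∫ v in (-v0)..v0, P (v * y))
        ≤ ∫ v in (-v0)..v0, P (v * (p * x + q * y)) := by
      rw [← intervalIntegral.integral_const_mul, ← intervalIntegral.integral_const_mul,
        ← intervalIntegral.integral_add ((hint x).const_mul p) ((hint y).const_mul q)]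
      apply intervalIntegral.integral_mono_on (by linarith)
        (((hint x).const_mul p).add ((hint y).const_mul q)) (hint _)
      intro v _
      have := hconc.2 (Set.mem_univ (v * x)) (Set.mem_univ (v * y)) hp hq hpq
      simp only [smul_eq_mul] at this
      have e : v * (p * x + q * y) = p * (v * x) + q * (v * y) := by ring
      rw [e]
      exact this
    simp only [smul_eq_mul, hf']
    have hk : 0 < 1 / (2 * v0) := by positivity
    have := mul_le_mul_of_nonneg_left key hk.le
    linarith
  · intro x
    simp only [hf', mul_neg, hPeven]
  · simp [hf', hP]
end

section
/- Let χ > 0 and let Z : ℝ → ℝ be continuous and strictly decreasing with lim_{x → −∞} Z(x) = 1/χ and lim_{x → +∞} Z(x) = −1/χ. Let z₀ : ℝ → ℝ be measurable with −1/χ ≤ z₀(x) ≤ 1/χ for almost every x and with z₀ − Z integrable on ℝ. Then for every ε > 0 there exist a measurable function z̃ : ℝ → ℝ and real numbers j, k such that Z(x − j) ≤ z̃(x) ≤ Z(x − k) for almost every x ∈ ℝ and ∫_ℝ |z̃(x) − z₀(x)| dx < ε. -/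
open MeasureTheory Real Filter

/-- Approximation step for the global `L¹`-stability of the viscous scalar
conservation law: admissible data taking values in `[−1/χ, 1/χ]` can be
`L¹`-approximated by functions sandwiched between two translates of the
monotone stationary profile `Z`. -/
theorem sandwich_approximation (chi : ℝ) (hchi : 0 < chi)
    (Z : ℝ → ℝ) (hZc : Continuous Z) (hZanti : StrictAnti Z)
    (hZbot : Tendsto Z atBot (nhds (1 / chi)))
    (hZtop : Tendsto Z atTop (nhds (-(1 / chi))))
    (z0 : ℝ → ℝ) (hz0m : Measurable z0)
    (hz0b : ∀ᵐ x : ℝ ∂(volume : Measure ℝ), -(1 / chi) ≤ z0 x ∧ z0 x ≤ 1 / chi)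
    (hz0i : Integrable (fun x : ℝ => z0 x - Z x))
    (ε : ℝ) (hε : 0 < ε) :
    ∃ (zt : ℝ → ℝ) (j k : ℝ), Measurable zt ∧
      (∀ᵐ x : ℝ ∂(volume : Measure ℝ), Z (x - j) ≤ zt x ∧ zt x ≤ Z (x - k)) ∧
      Integrable (fun x : ℝ => zt x - z0 x) ∧
      (∫ x : ℝ, |zt x - z0 x|) < ε := by
  have hb : ∀ (n : ℕ) (x : ℝ), |max (Z (x + n)) (min (z0 x) (Z (x - n))) - z0 x| ≤ |z0 x - Z x| := by
    intro n x
    have hn : (0 : ℝ) ≤ n := Nat.cast_nonneg n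
    have h1 : Z (x + n) ≤ Z x := hZanti.antitone (by linarith)
    have h2 : Z x ≤ Z (x - n) := hZanti.antitone (by linarith)
    rcases le_total (z0 x) (Z (x - n)) with h3 | h3
    · rw [min_eq_left h3]
      rcases le_total (Z (x + n)) (z0 x) with h4 | h4
      · rw [max_eq_right h4]; simp
      · rw [max_eq_left h4, abs_of_nonneg (by linarith), abs_of_nonpos (by linarith)]; linarith
    · rw [min_eq_right h3, max_eq_right (by linarith), abs_of_nonpos (by linarith),
        abs_of_nonneg (by linarith)]
      linarith
  have hm : ∀ n : ℕ, Measurable (fun x => max (Z (x + n)) (min (z0 x) (Z (x - n)))) := by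
    intro n
    exact (hZc.measurable.comp (measurable_id.add_const _)).max
      (hz0m.min (hZc.measurable.comp (measurable_id.sub_const _)))
  have hlim : Tendsto (fun n : ℕ => ∫ x : ℝ, |max (Z (x + n)) (min (z0 x) (Z (x - n))) - z0 x|)
      atTop (nhds (∫ _ : ℝ, (0 : ℝ))) := by
    refine tendsto_integral_of_dominated_convergence (fun x => |z0 x - Z x|) ?_ hz0i.abs ?_ ?_
    · intro n
      exact (continuous_abs.measurable.comp ((hm n).sub hz0m)).aestronglyMeasurable
    · intro n
      refine Eventually.of_forall fun x => ?_
      rw [Real.norm_eq_abs, abs_abs]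
      exact hb n x
    · filter_upwards [hz0b] with x hx
      have t1 : Tendsto (fun n : ℕ => Z (x + n)) atTop (nhds (-(1 / chi))) :=
        hZtop.comp (tendsto_atTop_add_const_left _ x tendsto_natCast_atTop_atTop)
      have t2 : Tendsto (fun n : ℕ => Z (x - n)) atTop (nhds (1 / chi)) := by
        refine hZbot.comp ?_
        simp only [sub_eq_add_neg]
        exact tendsto_atBot_add_const_left _ x
          (tendsto_neg_atTop_atBot.comp tendsto_natCast_atTop_atTop)
      have t3 := ((t1.max ((tendsto_const_nhds (x := z0 x)).min t2)).sub_const (z0 x)).abs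
      rw [min_eq_left hx.2, max_eq_right hx.1, sub_self, abs_zero] at t3
      exact t3
  rw [integral_zero] at hlim
  obtain ⟨n, hn⟩ := (hlim.eventually (gt_mem_nhds hε)).exists
  refine ⟨fun x => max (Z (x + n)) (min (z0 x) (Z (x - n))), -n, n, hm n, ?_, ?_, hn⟩
  · refine Eventually.of_forall fun x => ?_
    have h0 : (0 : ℝ) ≤ n := Nat.cast_nonneg n
    refine ⟨?_, max_le (hZanti.antitone (by linarith)) (min_le_right _ _)⟩
    rw [sub_neg_eq_add]
    exact le_max_left _ _
  · refine hz0i.mono ((hm n).sub hz0m).aestronglyMeasurable (Eventually.of_forall fun x => ?_)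
    exact hb n x
end
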